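/- arXiv:2409.06027 — 2 statements merged into one kernel-verified Lean document; each statement's English description precedes it below -/
import Mathlib

section
/- Let p be a prime and θ as below. Let R = { (a,b,c,x) ∈ ℚ_p⁴ : v_p(a) ≤ min{−1, v_p(b) − 1, v_p(ac − b²)} and v_p(x) ≤ v_p(a + bx) } (the conditions force a ≠ 0 and x ≠ 0 on R). There exists T ∈ ℝ such that for all ν₁, ν₂ ∈ ℂ with Re(ν₂) > T and Re(ν₁ − ν₂) > T, the function (a,b,c,x) ↦ |x|^{−1−ν₁+ν₂} · |a|^{−1−ν₂} · θ(−x − c) is absolutely integrable on R and ∫_R |x|^{−1−ν₁+ν₂} |a|^{−1−ν₂} θ(−x − c) da db dc dx = p^{−2−ν₁−2ν₂} − (1 − p⁻¹)·p^{−1−ν₁} − (1 − p⁻¹)·p^{−1−ν₁−ν₂}. -/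
open MeasureTheory

section

variable {p : ℕ} [Fact p.Prime]

theorem Padic.addValuation_le_coe_iff (a : ℚ_[p]) (n : ℤ) :
    Padic.addValuation a ≤ (n : WithTop ℤ) ↔ (p : ℝ) ^ (-n) ≤ ‖a‖ := by
  have hp : (1 : ℝ) < p := mod_cast (Fact.out : p.Prime).one_lt
  rcases eq_or_ne a 0 with rfl | ha
  · have : (0 : ℝ) < (p : ℝ) ^ (-n) := by positivity
    simp only [norm_zero, not_le.2 this, iff_false]
    simp
  · rw [Padic.addValuation.apply ha, Padic.norm_eq_zpow_neg_valuation ha, WithTop.coe_le_coe,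
      zpow_le_zpow_iff_right₀ hp, neg_le_neg_iff]

theorem Padic.addValuation_le_addValuation_iff (a b : ℚ_[p]) :
    Padic.addValuation a ≤ Padic.addValuation b ↔ ‖b‖ ≤ ‖a‖ := by
  rcases eq_or_ne b 0 with rfl | hb
  · simp
  · rw [Padic.addValuation.apply hb, Padic.addValuation_le_coe_iff,
      ← Padic.norm_eq_zpow_neg_valuation hb]

theorem Padic.addValuation_le_addValuation_sub_one_iff (a b : ℚ_[p]) :
    Padic.addValuation a ≤ Padic.addValuation b - 1 ↔ p * ‖b‖ ≤ ‖a‖ := by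
  have hp : (p : ℝ) ≠ 0 := mod_cast (Fact.out : p.Prime).ne_zero
  rcases eq_or_ne b 0 with rfl | hb
  · simp
  · have : Padic.addValuation b - 1 = ((b.valuation - 1 : ℤ) : WithTop ℤ) := by
      rw [Padic.addValuation.apply hb]; rfl
    rw [this, Padic.addValuation_le_coe_iff, Padic.norm_eq_zpow_neg_valuation hb, neg_sub,
      sub_eq_add_neg, zpow_add₀ hp, zpow_one]

/-- The centre of the fibre of the region over `(x, a)` in the `b`-coordinate. -/
noncomputable def fiberCenter (x a : ℚ_[p]) : ℚ_[p] := if ‖a‖ ≤ ‖x‖ then 0 else -a / x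

theorem mem_region_iff (a b c x : ℚ_[p]) :
    (Padic.addValuation a ≤ min ((-1 : ℤ) : WithTop ℤ)
        (min (Padic.addValuation b - 1) (Padic.addValuation (a * c - b ^ 2))) ∧
      Padic.addValuation x ≤ Padic.addValuation (a + b * x)) ↔
    (p ≤ ‖x‖ ∧ p ≤ ‖a‖) ∧ ‖b - fiberCenter x a‖ ≤ 1 ∧ ‖c - b ^ 2 / a‖ ≤ 1 := by
  have hp : (1 : ℝ) < p := mod_cast (Fact.out : p.Prime).one_lt
  rw [le_min_iff, le_min_iff, Padic.addValuation_le_coe_iff,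
    Padic.addValuation_le_addValuation_sub_one_iff, Padic.addValuation_le_addValuation_iff,
    Padic.addValuation_le_addValuation_iff, neg_neg, zpow_one]
  by_cases hpa : (p : ℝ) ≤ ‖a‖
  swap
  · simp [hpa]
  have ha : 0 < ‖a‖ := by linarith
  have ha0 : a ≠ 0 := norm_pos_iff.1 ha
  have hc : ‖c - b ^ 2 / a‖ ≤ 1 ↔ ‖a * c - b ^ 2‖ ≤ ‖a‖ := by
    rw [show c - b ^ 2 / a = (a * c - b ^ 2) / a by field_simp, norm_div, div_le_one ha]
  rw [hc]
  have hbx : ‖b * x‖ = ‖b‖ * ‖x‖ := norm_mul b x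
  have h₁ : ‖b * x‖ ≤ max ‖a + b * x‖ ‖a‖ := by
    simpa using Padic.nonarchimedean (a + b * x) (-a)
  have h₂ : ‖a‖ ≤ max ‖a + b * x‖ ‖b * x‖ := by
    simpa using Padic.nonarchimedean (a + b * x) (-(b * x))
  have h₃ : ‖a + b * x‖ ≤ max ‖a‖ ‖b * x‖ := Padic.nonarchimedean _ _
  unfold fiberCenter
  split_ifs with hax
  · have hx : 0 < ‖x‖ := by linarith
    rw [sub_zero]
    constructor
    · rintro ⟨⟨-, h, h'⟩, h''⟩
      refine ⟨⟨by linarith, hpa⟩, ?_, h'⟩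
      have : ‖b‖ * ‖x‖ ≤ ‖x‖ := hbx ▸ h₁.trans (max_le h'' hax)
      exact le_of_mul_le_mul_right (by linarith) hx
    · rintro ⟨-, h, h'⟩
      refine ⟨⟨hpa, by nlinarith, h'⟩, h₃.trans (max_le hax ?_)⟩
      rw [hbx]; nlinarith
  · push Not at hax
    rcases eq_or_ne x 0 with rfl | hx0
    · constructor
      · rintro ⟨-, h⟩
        simp only [mul_zero, add_zero] at h
        linarith
      · rintro ⟨⟨h, -⟩, -⟩
        rw [norm_zero] at h
        linarith
    have hx : 0 < ‖x‖ := norm_pos_iff.2 hx0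
    have hb : ‖b - -a / x‖ ≤ 1 ↔ ‖a + b * x‖ ≤ ‖x‖ := by
      rw [show b - -a / x = (a + b * x) / x by field_simp; ring, norm_div, div_le_one hx]
    rw [hb]
    constructor
    · rintro ⟨⟨-, h, h'⟩, h''⟩
      refine ⟨⟨?_, hpa⟩, h'', h'⟩
      rcases le_max_iff.1 h₂ with h₂ | h₂
      · linarith
      · rw [hbx] at h₂
        have hb : 0 < ‖b‖ := by
          by_contra hb
          have : ‖b‖ = 0 := le_antisymm (not_lt.1 hb) (norm_nonneg _)
          rw [this] at h₂; linarith
        by_contra hxp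
        nlinarith
    · rintro ⟨⟨hpx, -⟩, h, h'⟩
      refine ⟨⟨hpa, ?_, h'⟩, h⟩
      have : ‖b‖ * ‖x‖ ≤ ‖a‖ := hbx ▸ h₁.trans (max_le (by linarith) le_rfl)
      nlinarith [norm_nonneg b]

theorem character_eq_on_region {θ : ℚ_[p] → ℂ} (hθ_add : ∀ a b : ℚ_[p], θ (a + b) = θ a * θ b)
    (hθ_triv : ∀ a : ℚ_[p], ‖a‖ ≤ 1 → θ a = 1) {x a u w : ℚ_[p]} (hx : p ≤ ‖x‖) (ha : p ≤ ‖a‖)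
    (hu : ‖u‖ ≤ 1) (hw : ‖w‖ ≤ 1) :
    θ (-x - (w + (u + fiberCenter x a) ^ 2 / a)) = θ (-x) * θ (-(fiberCenter x a ^ 2 / a)) := by
  have hp : (1 : ℝ) < p := mod_cast (Fact.out : p.Prime).one_lt
  have ha0 : a ≠ 0 := norm_pos_iff.1 (by linarith)
  have hs : ‖fiberCenter x a / a‖ ≤ 1 := by
    unfold fiberCenter
    split_ifs with h
    · simp
    · have hx0 : x ≠ 0 := norm_pos_iff.1 (by linarith)
      rw [show -a / x / a = -x⁻¹ by field_simp, norm_neg, norm_inv]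
      exact inv_le_one_of_one_le₀ (by linarith)
  set s := fiberCenter x a
  have h2 : ‖(2 : ℚ_[p])‖ ≤ 1 := mod_cast Padic.norm_int_le_one (p := p) 2
  have ha1 : ‖a⁻¹‖ ≤ 1 := by rw [norm_inv]; exact inv_le_one_of_one_le₀ (by linarith)
  have key : ‖-(w + u * (2 * (s / a)) + u * (u * a⁻¹))‖ ≤ 1 := by
    rw [norm_neg]
    refine (Padic.nonarchimedean _ _).trans (max_le
      ((Padic.nonarchimedean _ _).trans (max_le hw ?_)) ?_)
    · rw [norm_mul, norm_mul]
      exact mul_le_one₀ hu (by positivity) (mul_le_one₀ h2 (by positivity) hs)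
    · rw [norm_mul, norm_mul]
      exact mul_le_one₀ hu (by positivity) (mul_le_one₀ hu (by positivity) ha1)
  rw [← hθ_add, show -x - (w + (u + s) ^ 2 / a) =
    (-x + -(s ^ 2 / a)) + -(w + u * (2 * (s / a)) + u * (u * a⁻¹)) by field_simp; ring,
    hθ_add _ (-(w + _ + _)), hθ_triv _ key, mul_one]

end

section

variable {p : ℕ} [Fact p.Prime]

theorem Padic.exists_norm_sub_natCast_div_le {x : ℚ_[p]} {n : ℕ} (hx : ‖x‖ ≤ (p : ℝ) ^ (n + 1)) :
    ∃ j < p, ‖x - (j : ℚ_[p]) / (p : ℚ_[p]) ^ (n + 1)‖ ≤ (p : ℝ) ^ n := by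
  have hp : (1 : ℝ) < p := mod_cast (Fact.out : p.Prime).one_lt
  have hp0 : (p : ℚ_[p]) ≠ 0 := mod_cast (Fact.out : p.Prime).ne_zero
  have hy : ‖x * (p : ℚ_[p]) ^ (n + 1)‖ ≤ 1 := by
    rw [norm_mul, norm_pow, Padic.norm_p, inv_pow, ← div_eq_mul_inv]
    exact div_le_one_of_le₀ hx (by positivity)
  obtain ⟨j, hj, hj'⟩ := PadicInt.exists_mem_range (⟨_, hy⟩ : ℤ_[p])
  refine ⟨j, hj, ?_⟩
  rw [IsLocalRing.mem_maximalIdeal, PadicInt.mem_nonunits, PadicInt.norm_def] at hj'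
  have h := (Padic.norm_le_pow_iff_norm_lt_pow_add_one
    (x * (p : ℚ_[p]) ^ (n + 1) - (j : ℚ_[p])) (-1)).2 (by
      rw [neg_add_cancel, zpow_zero]
      exact hj')
  rw [show x - (j : ℚ_[p]) / (p : ℚ_[p]) ^ (n + 1) = (x * (p : ℚ_[p]) ^ (n + 1) - (j : ℚ_[p])) / (p : ℚ_[p]) ^ (n + 1) by
    field_simp, norm_div, norm_pow, Padic.norm_p, div_le_iff₀ (by positivity)]
  refine h.trans_eq ?_
  rw [zpow_neg_one, inv_pow, pow_succ, mul_inv, ← mul_assoc, mul_inv_cancel₀ (by positivity),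
    one_mul]

theorem Padic.eq_of_norm_sub_natCast_div_le {x : ℚ_[p]} {n i j : ℕ} (hi : i < p) (hj : j < p)
    (hxi : ‖x - (i : ℚ_[p]) / (p : ℚ_[p]) ^ (n + 1)‖ ≤ (p : ℝ) ^ n)
    (hxj : ‖x - (j : ℚ_[p]) / (p : ℚ_[p]) ^ (n + 1)‖ ≤ (p : ℝ) ^ n) : i = j := by
  have hp : (1 : ℝ) < p := mod_cast (Fact.out : p.Prime).one_lt
  have hp0 : (p : ℚ_[p]) ≠ 0 := mod_cast (Fact.out : p.Prime).ne_zero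
  have h : ‖(((i : ℤ) - j : ℤ) : ℚ_[p]) / (p : ℚ_[p]) ^ (n + 1)‖ ≤ (p : ℝ) ^ n := by
    have := Padic.nonarchimedean (x - (j : ℚ_[p]) / (p : ℚ_[p]) ^ (n + 1)) (-(x - (i : ℚ_[p]) / (p : ℚ_[p]) ^ (n + 1)))
    rw [norm_neg] at this
    refine le_trans (le_of_eq ?_) (this.trans (max_le hxj hxi))
    congr 1
    push_cast
    ring
  rw [norm_div, norm_pow, Padic.norm_p, div_le_iff₀ (by positivity)] at h
  have h' : ‖(((i : ℤ) - j : ℤ) : ℚ_[p])‖ < 1 := by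
    refine h.trans_lt ?_
    rw [inv_pow, pow_succ, mul_inv, ← mul_assoc, mul_inv_cancel₀ (by positivity), one_mul]
    exact inv_lt_one_of_one_lt₀ hp
  rw [Padic.norm_intCast_lt_one_iff] at h'
  have := Int.eq_zero_of_abs_lt_dvd h' (by rw [abs_lt]; constructor <;> omega)
  omega

theorem Padic.exists_norm_eq_pow {x : ℚ_[p]} (hx : 1 ≤ ‖x‖) : ∃ n : ℕ, ‖x‖ = (p : ℝ) ^ n := by
  have hp : (1 : ℝ) < p := mod_cast (Fact.out : p.Prime).one_lt
  have h0 : x ≠ 0 := norm_pos_iff.1 (by linarith)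
  have h := Padic.norm_eq_zpow_neg_valuation h0
  rw [h, one_le_zpow_iff_right₀ hp] at hx
  obtain ⟨n, hn⟩ := Int.eq_ofNat_of_zero_le hx
  exact ⟨n, by rw [h, hn, zpow_natCast]⟩

variable [MeasurableSpace ℚ_[p]] [BorelSpace ℚ_[p]]

theorem measurableSet_norm_le (r : ℝ) : MeasurableSet {x : ℚ_[p] | ‖x‖ ≤ r} :=
  measurableSet_le measurable_norm measurable_const

variable {μ : Measure ℚ_[p]} [μ.IsAddLeftInvariant]

theorem measure_norm_le_pow (hμ : μ {x : ℚ_[p] | ‖x‖ ≤ 1} = 1) (n : ℕ) :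
    μ {x : ℚ_[p] | ‖x‖ ≤ (p : ℝ) ^ n} = (p : ENNReal) ^ n := by
  have hp : (1 : ℝ) < p := mod_cast (Fact.out : p.Prime).one_lt
  induction n with
  | zero => simpa using hμ
  | succ n ih =>
    have hU : {x : ℚ_[p] | ‖x‖ ≤ (p : ℝ) ^ (n + 1)} = ⋃ j ∈ Finset.range p,
        {x : ℚ_[p] | ‖x - (j : ℚ_[p]) / (p : ℚ_[p]) ^ (n + 1)‖ ≤ (p : ℝ) ^ n} := by
      ext x
      simp only [Set.mem_ofPred_eq, Set.mem_iUnion, Finset.mem_range, exists_prop]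
      refine ⟨Padic.exists_norm_sub_natCast_div_le, ?_⟩
      rintro ⟨j, -, hj⟩
      have := Padic.nonarchimedean (x - (j : ℚ_[p]) / (p : ℚ_[p]) ^ (n + 1)) ((j : ℚ_[p]) / (p : ℚ_[p]) ^ (n + 1))
      rw [sub_add_cancel] at this
      refine this.trans (max_le (hj.trans (pow_le_pow_right₀ hp.le n.le_succ)) ?_)
      rw [norm_div, norm_pow, Padic.norm_p, inv_pow, div_inv_eq_mul]
      have : ‖(j : ℚ_[p])‖ ≤ 1 := mod_cast Padic.norm_int_le_one (p := p) j
      exact mul_le_of_le_one_left (by positivity) this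
    rw [hU, measure_biUnion_finset]
    · have (j : ℕ) : μ {x : ℚ_[p] | ‖x - (j : ℚ_[p]) / (p : ℚ_[p]) ^ (n + 1)‖ ≤ (p : ℝ) ^ n} = p ^ n := by
        rw [← ih, ← measure_preimage_add μ ((j : ℚ_[p]) / (p : ℚ_[p]) ^ (n + 1))]
        congr 1
        ext x
        simp
      simp only [this]
      simp [pow_succ, mul_comm]
    · intro i hi j hj hij
      rw [Function.onFun, Set.disjoint_left]
      exact fun x hxi hxj ↦ hij (Padic.eq_of_norm_sub_natCast_div_le
        (by simpa using hi) (by simpa using hj) hxi hxj)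
    · exact fun j _ ↦ measurableSet_le (by fun_prop) measurable_const

theorem measureReal_norm_le_pow (hμ : μ {x : ℚ_[p] | ‖x‖ ≤ 1} = 1) (n : ℕ) :
    μ.real {x : ℚ_[p] | ‖x‖ ≤ (p : ℝ) ^ n} = (p : ℝ) ^ n := by
  simp [Measure.real, measure_norm_le_pow hμ]

theorem measure_norm_le_lt_top (hμ : μ {x : ℚ_[p] | ‖x‖ ≤ 1} = 1) (r : ℝ) :
    μ {x : ℚ_[p] | ‖x‖ ≤ r} < ⊤ := by
  have hp : (1 : ℝ) < p := mod_cast (Fact.out : p.Prime).one_lt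
  obtain ⟨n, hn⟩ := pow_unbounded_of_one_lt r hp
  have hsub : {x : ℚ_[p] | ‖x‖ ≤ r} ⊆ {x : ℚ_[p] | ‖x‖ ≤ (p : ℝ) ^ n} :=
    fun x hx ↦ le_trans hx hn.le
  refine (measure_mono hsub).trans_lt ?_
  rw [measure_norm_le_pow hμ]
  exact ENNReal.pow_lt_top (ENNReal.natCast_lt_top p)

/-- `‖·‖⁻²` is integrable away from the origin. -/
theorem integrable_indicator_norm_inv_sq (hμ : μ {x : ℚ_[p] | ‖x‖ ≤ 1} = 1) :
    Integrable ({x : ℚ_[p] | p ≤ ‖x‖}.indicator fun x ↦ (‖x‖ ^ 2)⁻¹) μ := by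
  have hp : (1 : ℝ) < p := mod_cast (Fact.out : p.Prime).one_lt
  have hm : MeasurableSet {x : ℚ_[p] | p ≤ ‖x‖} := measurableSet_le measurable_const measurable_norm
  refine ⟨(Measurable.indicator (by fun_prop) hm).aestronglyMeasurable, ?_⟩
  have hle (x : ℚ_[p]) : ‖{x : ℚ_[p] | p ≤ ‖x‖}.indicator (fun x ↦ (‖x‖ ^ 2)⁻¹) x‖ₑ ≤
      ∑' n : ℕ, {x : ℚ_[p] | ‖x‖ ≤ (p : ℝ) ^ n}.indicator
        (fun _ ↦ ENNReal.ofReal (((p : ℝ) ^ n) ^ 2)⁻¹) x := by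
    by_cases hx : p ≤ ‖x‖
    · obtain ⟨n, hn⟩ := Padic.exists_norm_eq_pow (hp.le.trans hx)
      refine le_trans ?_ (ENNReal.le_tsum n)
      rw [Set.indicator_of_mem (show x ∈ {x : ℚ_[p] | p ≤ ‖x‖} from hx),
        Set.indicator_of_mem (show x ∈ {x : ℚ_[p] | ‖x‖ ≤ (p : ℝ) ^ n} from hn.le),
        Real.enorm_of_nonneg (by positivity), hn]
    · rw [Set.indicator_of_notMem (show x ∉ {x : ℚ_[p] | p ≤ ‖x‖} from hx)]
      simp
  refine (lintegral_mono hle).trans_lt ?_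
  rw [lintegral_tsum fun n ↦ (measurable_const.indicator (measurableSet_norm_le _)).aemeasurable]
  simp_rw [lintegral_indicator_const (measurableSet_norm_le _), measure_norm_le_pow hμ]
  have hterm (n : ℕ) : ENNReal.ofReal (((p : ℝ) ^ n) ^ 2)⁻¹ * (p : ENNReal) ^ n =
      ENNReal.ofReal ((p : ℝ)⁻¹ ^ n) := by
    rw [← ENNReal.ofReal_natCast p, ← ENNReal.ofReal_pow (by positivity),
      ← ENNReal.ofReal_mul (by positivity)]
    congr 1
    rw [inv_pow]
    field_simp
  simp_rw [hterm]
  exact (summable_geometric_of_lt_one (by positivity) (inv_lt_one_of_one_lt₀ hp)).tsum_ofReal_lt_top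

end

section

variable {p : ℕ} [Fact p.Prime]

theorem Padic.prime_le_norm {x : ℚ_[p]} (hx : 1 < ‖x‖) : p ≤ ‖x‖ := by
  have := Padic.norm_le_pow_iff_norm_lt_pow_add_one x 0
  simp only [zpow_zero, zero_add, zpow_one] at this
  exact not_lt.1 fun h ↦ hx.not_ge (this.2 h)

theorem Padic.prime_mul_norm_le {a y : ℚ_[p]} (hy : y ≠ 0) (h : ‖y‖ < ‖a‖) :
    p * ‖y‖ ≤ ‖a‖ := by
  have hy' : 0 < ‖y‖ := norm_pos_iff.2 hy
  have := Padic.prime_le_norm (x := a / y) (by rwa [norm_div, one_lt_div hy'])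
  rwa [norm_div, le_div_iff₀ hy'] at this

theorem Padic.norm_add_le_iff {x t : ℚ_[p]} {r : ℝ} (ht : ‖t‖ ≤ r) : ‖x + t‖ ≤ r ↔ ‖x‖ ≤ r := by
  refine ⟨fun h ↦ ?_, fun h ↦ (Padic.nonarchimedean x t).trans (max_le h ht)⟩
  have := Padic.nonarchimedean (x + t) (-t)
  rw [add_neg_cancel_right, norm_neg] at this
  exact this.trans (max_le h ht)

theorem Padic.norm_add_eq_of_lt {x t : ℚ_[p]} (h : ‖t‖ < ‖x‖) : ‖x + t‖ = ‖x‖ := by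
  refine le_antisymm ((Padic.norm_add_le_iff h.le).2 le_rfl) (not_lt.1 fun h' ↦ ?_)
  have := Padic.nonarchimedean (x + t) (-t)
  rw [add_neg_cancel_right, norm_neg] at this
  exact (this.trans_lt (max_lt h' h)).false

theorem Complex.norm_ofReal_cpow_le_inv_sq {r : ℝ} (hr : 1 ≤ r) {β : ℂ} (hβ : β.re ≤ -2) :
    ‖(r : ℂ) ^ β‖ ≤ (r ^ 2)⁻¹ := by
  rw [Complex.norm_cpow_eq_rpow_re_of_pos (by linarith)]
  refine (Real.rpow_le_rpow_of_exponent_le hr hβ).trans_eq ?_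
  rw [Real.rpow_neg (by linarith)]
  norm_num

variable [MeasurableSpace ℚ_[p]] [BorelSpace ℚ_[p]] {μ : Measure ℚ_[p]}

theorem integral_indicator_norm_le_one (r : ℝ) :
    ∫ x, {x : ℚ_[p] | ‖x‖ ≤ r}.indicator (fun _ ↦ (1 : ℂ)) x ∂μ =
      (μ.real {x : ℚ_[p] | ‖x‖ ≤ r} : ℂ) := by
  rw [integral_indicator (measurableSet_norm_le _), setIntegral_const]
  simp

variable [μ.IsAddLeftInvariant]

theorem integral_eq_zero_of_add_right_eq_mul {f : ℚ_[p] → ℂ} (t : ℚ_[p]) {ζ : ℂ} (hζ : ζ ≠ 1)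
    (hf : ∀ x, f (x + t) = ζ * f x) : ∫ x, f x ∂μ = 0 := by
  have h := integral_add_right_eq_self (μ := μ) f t
  simp_rw [hf, integral_const_mul] at h
  have : (ζ - 1) * ∫ x, f x ∂μ = 0 := by rw [sub_mul, h, one_mul, sub_self]
  exact (mul_eq_zero.1 this).resolve_left (sub_ne_zero.2 hζ)

theorem integrable_indicator_norm_le (hμ : μ {x : ℚ_[p] | ‖x‖ ≤ 1} = 1) {f : ℚ_[p] → ℂ}
    (hf : Measurable f) (hf1 : ∀ x, ‖f x‖ ≤ 1) (r : ℝ) :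
    Integrable ({x : ℚ_[p] | ‖x‖ ≤ r}.indicator f) μ :=
  (integrable_indicator_iff (measurableSet_norm_le _)).2 <|
    Measure.integrableOn_of_bounded (measure_norm_le_lt_top hμ r).ne hf.aestronglyMeasurable
      (M := 1) (ae_of_all _ hf1)

theorem integrable_of_norm_le_indicator_inv_sq (hμ : μ {x : ℚ_[p] | ‖x‖ ≤ 1} = 1)
    {f : ℚ_[p] → ℂ} (hf : Measurable f) (h0 : ∀ x, ¬ p ≤ ‖x‖ → f x = 0)
    (h1 : ∀ x, p ≤ ‖x‖ → ‖f x‖ ≤ (‖x‖ ^ 2)⁻¹) : Integrable f μ := by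
  refine (integrable_indicator_norm_inv_sq hμ).mono' hf.aestronglyMeasurable (ae_of_all _ fun x ↦ ?_)
  by_cases hx : p ≤ ‖x‖
  · rw [Set.indicator_of_mem (show x ∈ {x : ℚ_[p] | p ≤ ‖x‖} from hx)]
    exact h1 x hx
  · rw [Set.indicator_of_notMem (show x ∉ {x : ℚ_[p] | p ≤ ‖x‖} from hx), h0 x hx, norm_zero]

/-- The integral of a character of conductor `ℤ_p` over the first sphere on which it is
nontrivial. -/
theorem integral_indicator_sphere_character (hμ : μ {x : ℚ_[p] | ‖x‖ ≤ 1} = 1) {θ : ℚ_[p] → ℂ}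
    (hθ : Measurable θ) (hθ_add : ∀ a b : ℚ_[p], θ (a + b) = θ a * θ b)
    (hθ_unit : ∀ a : ℚ_[p], ‖θ a‖ = 1) (hθ_triv : ∀ a : ℚ_[p], ‖a‖ ≤ 1 → θ a = 1)
    {t : ℚ_[p]} (ht : ‖t‖ ≤ p) (hθt : θ (-t) ≠ 1) {y : ℚ_[p]} (hy : y ≠ 0) :
    ∫ a, {a : ℚ_[p] | ‖a‖ = p * ‖y‖}.indicator (fun a ↦ θ (-(a / y))) a ∂μ =
      -(μ.real {a : ℚ_[p] | ‖a‖ ≤ ‖y‖} : ℂ) := by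
  have hp : (1 : ℝ) < p := mod_cast (Fact.out : p.Prime).one_lt
  have hy' : 0 < ‖y‖ := norm_pos_iff.2 hy
  have hsplit (a : ℚ_[p]) : {a : ℚ_[p] | ‖a‖ = p * ‖y‖}.indicator (fun a ↦ θ (-(a / y))) a =
      {a : ℚ_[p] | ‖a‖ ≤ p * ‖y‖}.indicator (fun a ↦ θ (-(a / y))) a -
        {a : ℚ_[p] | ‖a‖ ≤ ‖y‖}.indicator (fun _ ↦ (1 : ℂ)) a := by
    simp only [Set.indicator_apply, Set.mem_ofPred_eq]
    by_cases h : ‖a‖ ≤ ‖y‖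
    · have h1 : ‖a‖ ≠ p * ‖y‖ := fun h' ↦ by nlinarith
      have h2 : ‖a‖ ≤ p * ‖y‖ := by nlinarith
      rw [if_neg h1, if_pos h2, if_pos h, hθ_triv, sub_self]
      rw [norm_neg, norm_div]
      exact div_le_one_of_le₀ h hy'.le
    · have h1 := Padic.prime_mul_norm_le hy (not_le.1 h)
      rw [if_neg h, sub_zero]
      simp only [le_antisymm_iff, h1, and_true]
  simp_rw [hsplit]
  rw [integral_sub, integral_indicator_norm_le_one, sub_eq_neg_self]
  · refine integral_eq_zero_of_add_right_eq_mul (t * y) hθt fun a ↦ ?_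
    have hty : ‖t * y‖ ≤ p * ‖y‖ := by rw [norm_mul]; gcongr
    simp only [Set.indicator_apply, Set.mem_ofPred_eq, Padic.norm_add_le_iff hty, mul_ite, mul_zero]
    rw [← hθ_add]
    congr 2
    field_simp
    ring
  · exact integrable_indicator_norm_le hμ (by fun_prop) (fun x ↦ (hθ_unit _).le) _
  · exact integrable_indicator_norm_le hμ (by fun_prop) (by simp) _

theorem measurable_fiberCenter : Measurable fun z : ℚ_[p] × ℚ_[p] ↦ fiberCenter z.1 z.2 := by
  unfold fiberCenter
  exact Measurable.ite (measurableSet_le (by fun_prop) (by fun_prop)) (by fun_prop) (by fun_prop)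

theorem integral_fiber_character (hμ : μ {x : ℚ_[p] | ‖x‖ ≤ 1} = 1) {θ : ℚ_[p] → ℂ}
    (hθ : Measurable θ) (hθ_add : ∀ a b : ℚ_[p], θ (a + b) = θ a * θ b)
    (hθ_unit : ∀ a : ℚ_[p], ‖θ a‖ = 1) (hθ_triv : ∀ a : ℚ_[p], ‖a‖ ≤ 1 → θ a = 1)
    {t : ℚ_[p]} (ht : ‖t‖ ≤ p) (hθt : θ (-t) ≠ 1) {β : ℂ} (hβ : β.re ≤ -2)
    {x : ℚ_[p]} (hx : p ≤ ‖x‖) :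
    ∫ a, {a : ℚ_[p] | p ≤ ‖a‖}.indicator
        (fun a ↦ (‖a‖ : ℂ) ^ β * θ (-(fiberCenter x a ^ 2 / a))) a ∂μ =
      ∫ a, {a : ℚ_[p] | p ≤ ‖a‖ ∧ ‖a‖ ≤ ‖x‖ ^ 2}.indicator (fun a ↦ (‖a‖ : ℂ) ^ β) a ∂μ -
        ((p * ‖x‖ ^ 2 : ℝ) : ℂ) ^ β * μ.real {a : ℚ_[p] | ‖a‖ ≤ ‖x‖ ^ 2} := by
  have hp : (1 : ℝ) < p := mod_cast (Fact.out : p.Prime).one_lt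
  have hx0 : x ≠ 0 := norm_pos_iff.1 (by linarith)
  have hx2 : ‖x ^ 2‖ = ‖x‖ ^ 2 := norm_pow x 2
  have hxx : p ≤ ‖x‖ ^ 2 := by nlinarith
  have hsplit (a : ℚ_[p]) : {a : ℚ_[p] | p ≤ ‖a‖}.indicator
        (fun a ↦ (‖a‖ : ℂ) ^ β * θ (-(fiberCenter x a ^ 2 / a))) a =
      {a : ℚ_[p] | p ≤ ‖a‖ ∧ ‖a‖ ≤ ‖x‖ ^ 2}.indicator (fun a ↦ (‖a‖ : ℂ) ^ β) a +
      ((p * ‖x‖ ^ 2 : ℝ) : ℂ) ^ β *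
        {a : ℚ_[p] | ‖a‖ = p * ‖x ^ 2‖}.indicator (fun a ↦ θ (-(a / x ^ 2))) a +
      {a : ℚ_[p] | p * ‖x ^ 2‖ < ‖a‖}.indicator
        (fun a ↦ (‖a‖ : ℂ) ^ β * θ (-(a / x ^ 2))) a := by
    simp only [Set.indicator_apply, Set.mem_ofPred_eq, hx2]
    by_cases ha : p ≤ ‖a‖
    swap
    · have h1 : ‖a‖ ≠ p * ‖x‖ ^ 2 := fun h' ↦ by nlinarith
      have h2 : ¬ p * ‖x‖ ^ 2 < ‖a‖ := by nlinarith
      simp [ha, h1, h2]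
    have ha0 : a ≠ 0 := norm_pos_iff.1 (by linarith)
    have hc (h : ‖x‖ < ‖a‖) : fiberCenter x a ^ 2 / a = a / x ^ 2 := by
      rw [fiberCenter, if_neg (not_le.2 h)]
      field_simp
    by_cases h : ‖a‖ ≤ ‖x‖ ^ 2
    · have h1 : ‖a‖ ≠ p * ‖x‖ ^ 2 := fun h' ↦ by nlinarith
      have h2 : ¬ p * ‖x‖ ^ 2 < ‖a‖ := by nlinarith
      have h3 : θ (-(fiberCenter x a ^ 2 / a)) = 1 := by
        apply hθ_triv
        rw [norm_neg]
        by_cases hax : ‖a‖ ≤ ‖x‖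
        · simp [fiberCenter, hax]
        · rw [hc (not_le.1 hax), norm_div, hx2]
          exact div_le_one_of_le₀ h (by positivity)
      simp [ha, h, h1, h2, h3]
    · have h1 := Padic.prime_mul_norm_le (pow_ne_zero 2 hx0) (hx2 ▸ not_le.1 h)
      rw [hx2] at h1
      rw [hc (by nlinarith)]
      rcases h1.eq_or_lt with h2 | h2
      · rw [h2]
        simp [ha, h]
      · simp [ha, h, h2, h2.ne']
  have hnorm (a : ℚ_[p]) (ha : p ≤ ‖a‖) : ‖(‖a‖ : ℂ) ^ β‖ ≤ (‖a‖ ^ 2)⁻¹ :=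
    Complex.norm_ofReal_cpow_le_inv_sq (by linarith) hβ
  have hI1 : Integrable ({a : ℚ_[p] | p ≤ ‖a‖ ∧ ‖a‖ ≤ ‖x‖ ^ 2}.indicator
      (fun a ↦ (‖a‖ : ℂ) ^ β)) μ := by
    have hm : MeasurableSet {a : ℚ_[p] | p ≤ ‖a‖ ∧ ‖a‖ ≤ ‖x‖ ^ 2} := by
      rw [Set.ofPred_and]
      exact (measurableSet_le (by fun_prop) (by fun_prop)).inter (measurableSet_norm_le _)
    refine integrable_of_norm_le_indicator_inv_sq hμ (Measurable.indicator (by fun_prop) hm)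
      (fun a ha ↦ ?_) (fun a ha ↦ ?_)
    · simp [ha]
    · exact (norm_indicator_le_norm_self _ _).trans (hnorm a ha)
  have hI2 : Integrable ({a : ℚ_[p] | ‖a‖ = p * ‖x ^ 2‖}.indicator
      (fun a ↦ θ (-(a / x ^ 2)))) μ := by
    refine (integrable_indicator_norm_le hμ (f := fun a ↦ θ (-(a / x ^ 2))) (by fun_prop)
      (fun x ↦ (hθ_unit _).le) (p * ‖x ^ 2‖)).mono (Measurable.indicator (by fun_prop)
        (measurableSet_eq_fun (by fun_prop) (by fun_prop))).aestronglyMeasurable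
        (ae_of_all _ fun a ↦ ?_)
    exact norm_indicator_le_of_subset (fun a ha ↦ le_of_eq ha) _ _
  have hI3 : Integrable ({a : ℚ_[p] | p * ‖x ^ 2‖ < ‖a‖}.indicator
      (fun a ↦ (‖a‖ : ℂ) ^ β * θ (-(a / x ^ 2)))) μ := by
    refine integrable_of_norm_le_indicator_inv_sq hμ (Measurable.indicator (by fun_prop)
      (measurableSet_lt (by fun_prop) (by fun_prop))) (fun a ha ↦ ?_) (fun a ha ↦ ?_)
    · refine Set.indicator_of_notMem (fun h ↦ ha ?_) _
      have h : p * ‖x ^ 2‖ < ‖a‖ := h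
      nlinarith
    · refine (norm_indicator_le_norm_self _ _).trans ?_
      rw [norm_mul, hθ_unit, mul_one]
      exact hnorm a ha
  have hI3' : ∫ a, {a : ℚ_[p] | p * ‖x ^ 2‖ < ‖a‖}.indicator
      (fun a ↦ (‖a‖ : ℂ) ^ β * θ (-(a / x ^ 2))) a ∂μ = 0 := by
    refine integral_eq_zero_of_add_right_eq_mul (t * x ^ 2) hθt fun a ↦ ?_
    have hty : ‖t * x ^ 2‖ ≤ p * ‖x ^ 2‖ := by rw [norm_mul]; gcongr
    simp only [Set.indicator_apply, Set.mem_ofPred_eq, mul_ite, mul_zero]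
    have hiff : p * ‖x ^ 2‖ < ‖a + t * x ^ 2‖ ↔ p * ‖x ^ 2‖ < ‖a‖ := by
      rw [← not_le, Padic.norm_add_le_iff hty, not_le]
    simp only [hiff]
    split_ifs with h
    · rw [Padic.norm_add_eq_of_lt (hty.trans_lt h), mul_left_comm, ← hθ_add]
      congr 3
      field_simp
      ring
    · rfl
  simp_rw [hsplit]
  have hI2' := hI2.const_mul (((p * ‖x‖ ^ 2 : ℝ) : ℂ) ^ β)
  have hI12 := hI1.add hI2'
  simp only [Pi.add_def] at hI12
  rw [integral_add hI12 hI3, integral_add hI1 hI2', integral_const_mul, integral_indicator_sphere_character hμ hθ hθ_add hθ_unit hθ_triv ht hθt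
      (pow_ne_zero 2 hx0), hI3', hx2]
  ring

theorem integral_norm_mul_character (hμ : μ {x : ℚ_[p] | ‖x‖ ≤ 1} = 1) {θ : ℚ_[p] → ℂ}
    (hθ : Measurable θ) (hθ_add : ∀ a b : ℚ_[p], θ (a + b) = θ a * θ b)
    (hθ_unit : ∀ a : ℚ_[p], ‖θ a‖ = 1) (hθ_triv : ∀ a : ℚ_[p], ‖a‖ ≤ 1 → θ a = 1)
    {t : ℚ_[p]} (ht : ‖t‖ ≤ p) (hθt : θ (-t) ≠ 1) {g : ℝ → ℂ}
    (hg : Integrable ({x : ℚ_[p] | p ≤ ‖x‖}.indicator fun x ↦ g ‖x‖ * θ (-x)) μ) :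
    ∫ x, {x : ℚ_[p] | p ≤ ‖x‖}.indicator (fun x ↦ g ‖x‖ * θ (-x)) x ∂μ = -g p := by
  have hp : (1 : ℝ) < p := mod_cast (Fact.out : p.Prime).one_lt
  have hS : MeasurableSet {x : ℚ_[p] | ‖x‖ ≤ p} := measurableSet_norm_le _
  rw [← integral_add_compl hS hg, ← integral_indicator hS, ← integral_indicator hS.compl]
  have h1 (x : ℚ_[p]) : {x : ℚ_[p] | ‖x‖ ≤ p}.indicator
      ({x : ℚ_[p] | p ≤ ‖x‖}.indicator fun x ↦ g ‖x‖ * θ (-x)) x =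
      g p * {a : ℚ_[p] | ‖a‖ = p * ‖(1 : ℚ_[p])‖}.indicator (fun a ↦ θ (-(a / 1))) x := by
    simp only [Set.indicator_apply, Set.mem_ofPred_eq, norm_one, mul_one, div_one]
    rcases lt_trichotomy ‖x‖ p with h | h | h
    · simp [h.ne, not_le.2 h]
    · simp [h]
    · simp [h.ne', not_le.2 h]
  have h2 : ∫ x, {x : ℚ_[p] | ‖x‖ ≤ p}ᶜ.indicator
      ({x : ℚ_[p] | p ≤ ‖x‖}.indicator fun x ↦ g ‖x‖ * θ (-x)) x ∂μ = 0 := by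
    refine integral_eq_zero_of_add_right_eq_mul t hθt fun x ↦ ?_
    simp only [Set.indicator_apply, Set.mem_compl_iff, Set.mem_ofPred_eq,
      Padic.norm_add_le_iff ht]
    by_cases h : ‖x‖ ≤ p
    · simp [h]
    · have h' := not_le.1 h
      simp only [Padic.norm_add_eq_of_lt (ht.trans_lt h'), h, h'.le, not_false_eq_true, if_true]
      rw [mul_left_comm, ← hθ_add, neg_add_rev]
  simp_rw [h1]
  rw [h2, integral_const_mul, integral_indicator_sphere_character hμ hθ hθ_add hθ_unit hθ_triv ht
    hθt one_ne_zero, norm_one, measureReal_def, hμ]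
  simp

theorem integral_indicator_annulus (hμ : μ {x : ℚ_[p] | ‖x‖ ≤ 1} = 1) (β : ℂ) :
    ∫ a, {a : ℚ_[p] | p ≤ ‖a‖ ∧ ‖a‖ ≤ (p : ℝ) ^ 2}.indicator (fun a ↦ (‖a‖ : ℂ) ^ β) a ∂μ =
      (p : ℂ) ^ β * (p - 1) + ((p : ℂ) ^ 2) ^ β * (p ^ 2 - p) := by
  have hp : (1 : ℝ) < p := mod_cast (Fact.out : p.Prime).one_lt
  have hp0 : (p : ℚ_[p]) ≠ 0 := mod_cast (Fact.out : p.Prime).ne_zero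
  let χ (n : ℕ) : ℚ_[p] → ℂ := {a : ℚ_[p] | ‖a‖ ≤ (p : ℝ) ^ n}.indicator fun _ ↦ 1
  have hχ (n : ℕ) : Integrable (χ n) μ :=
    integrable_indicator_norm_le hμ (by fun_prop) (by simp) _
  have hχi (n : ℕ) : ∫ a, χ n a ∂μ = (p : ℂ) ^ n := by
    rw [integral_indicator_norm_le_one, measureReal_norm_le_pow hμ]
    simp
  have hsplit (a : ℚ_[p]) : {a : ℚ_[p] | p ≤ ‖a‖ ∧ ‖a‖ ≤ (p : ℝ) ^ 2}.indicator
      (fun a ↦ (‖a‖ : ℂ) ^ β) a =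
      (p : ℂ) ^ β * (χ 1 a - χ 0 a) + ((p : ℂ) ^ 2) ^ β * (χ 2 a - χ 1 a) := by
    simp only [χ, Set.indicator_apply, Set.mem_ofPred_eq, pow_one, pow_zero]
    by_cases h0 : ‖a‖ ≤ 1
    · have h1 : ¬ p ≤ ‖a‖ := by linarith
      have h2 : ‖a‖ ≤ p := by linarith
      have h3 : ‖a‖ ≤ p ^ 2 := by nlinarith
      simp [h0, h1, h2, h3]
    have h1 := Padic.prime_le_norm (not_le.1 h0)
    rcases h1.eq_or_lt with h2 | h2
    · have h3 : ‖a‖ ≤ p ^ 2 := by nlinarith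
      simp only [h0, h1, h2.ge, h3, and_self, if_true, if_false]
      rw [← h2]
      simp
    · have h3 : (p : ℝ) ^ 2 ≤ ‖a‖ := by
        have := Padic.prime_mul_norm_le (a := a) (inv_ne_zero hp0)
          (by rwa [norm_inv, Padic.norm_p, inv_inv])
        rwa [norm_inv, Padic.norm_p, inv_inv, ← sq] at this
      by_cases h4 : ‖a‖ ≤ p ^ 2
      · simp only [h0, h1, not_le.2 h2, h4, and_self, if_true, if_false]
        rw [le_antisymm h4 h3]
        simp
      · simp [h0, not_le.2 h2, h4]
  simp_rw [hsplit]
  rw [integral_add, integral_const_mul, integral_const_mul, integral_sub, integral_sub,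
    hχi, hχi, hχi]
  · simp
  all_goals first | exact hχ _ | exact ((hχ _).sub (hχ _)).const_mul _

theorem integrable_straightened_integrand (hμ : μ {x : ℚ_[p] | ‖x‖ ≤ 1} = 1) [SigmaFinite μ] {θ : ℚ_[p] → ℂ}
    (hθ : Measurable θ) (hθ_unit : ∀ a : ℚ_[p], ‖θ a‖ = 1)
    {α β : ℂ} (hα : α.re ≤ -2) (hβ : β.re ≤ -2) :
    Integrable ({z : ℚ_[p] × ℚ_[p] | p ≤ ‖z.1‖ ∧ p ≤ ‖z.2‖}.indicator fun z ↦
      (‖z.1‖ : ℂ) ^ α * (‖z.2‖ : ℂ) ^ β * (θ (-z.1) * θ (-(fiberCenter z.1 z.2 ^ 2 / z.2))))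
      (μ.prod μ) := by
  have hp : (1 : ℝ) < p := mod_cast (Fact.out : p.Prime).one_lt
  have hs := measurable_fiberCenter (p := p)
  have hm : MeasurableSet {z : ℚ_[p] × ℚ_[p] | p ≤ ‖z.1‖ ∧ p ≤ ‖z.2‖} := by
    rw [Set.ofPred_and]
    exact (measurableSet_le (by fun_prop) (by fun_prop)).inter
      (measurableSet_le (by fun_prop) (by fun_prop))
  refine ((integrable_indicator_norm_inv_sq hμ).mul_prod (integrable_indicator_norm_inv_sq hμ)).mono'
    (Measurable.indicator (by fun_prop) hm).aestronglyMeasurable (ae_of_all _ fun z ↦ ?_)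
  by_cases hz : p ≤ ‖z.1‖ ∧ p ≤ ‖z.2‖
  · simp only [Set.indicator_apply, Set.mem_ofPred_eq, hz, and_self, if_true, norm_mul, hθ_unit,
      mul_one]
    exact mul_le_mul (Complex.norm_ofReal_cpow_le_inv_sq (by linarith) hα)
      (Complex.norm_ofReal_cpow_le_inv_sq (by linarith) hβ) (norm_nonneg _) (by positivity)
  · rw [Set.indicator_of_notMem (by exact hz), norm_zero]
    exact mul_nonneg (Set.indicator_nonneg (fun _ _ ↦ by positivity) _)
      (Set.indicator_nonneg (fun _ _ ↦ by positivity) _)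

theorem integral_straightened_integrand (hμ : μ {x : ℚ_[p] | ‖x‖ ≤ 1} = 1) [SigmaFinite μ] {θ : ℚ_[p] → ℂ}
    (hθ : Measurable θ) (hθ_add : ∀ a b : ℚ_[p], θ (a + b) = θ a * θ b)
    (hθ_unit : ∀ a : ℚ_[p], ‖θ a‖ = 1) (hθ_triv : ∀ a : ℚ_[p], ‖a‖ ≤ 1 → θ a = 1)
    {t : ℚ_[p]} (ht : ‖t‖ ≤ p) (hθt : θ (-t) ≠ 1) {α β : ℂ} (hα : α.re ≤ -2) (hβ : β.re ≤ -2) :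
    ∫ z, {z : ℚ_[p] × ℚ_[p] | p ≤ ‖z.1‖ ∧ p ≤ ‖z.2‖}.indicator (fun z ↦
      (‖z.1‖ : ℂ) ^ α * (‖z.2‖ : ℂ) ^ β * (θ (-z.1) * θ (-(fiberCenter z.1 z.2 ^ 2 / z.2)))) z
      ∂μ.prod μ =
    (p : ℂ) ^ α * (((p : ℂ) ^ β) ^ 3 * p ^ 2 - (p : ℂ) ^ β * (p - 1) -
      ((p : ℂ) ^ β) ^ 2 * (p ^ 2 - p)) := by
  have hH := integrable_straightened_integrand hμ hθ hθ_unit hα hβ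
  rw [integral_prod _ hH]
  have hH' := hH.integral_prod_left
  let g (r : ℝ) : ℂ := (r : ℂ) ^ α *
    (∫ a, {a : ℚ_[p] | p ≤ ‖a‖ ∧ ‖a‖ ≤ r ^ 2}.indicator (fun a ↦ (‖a‖ : ℂ) ^ β) a ∂μ -
      ((p * r ^ 2 : ℝ) : ℂ) ^ β * μ.real {a : ℚ_[p] | ‖a‖ ≤ r ^ 2})
  have hinner (x : ℚ_[p]) :
      ∫ a, {z : ℚ_[p] × ℚ_[p] | p ≤ ‖z.1‖ ∧ p ≤ ‖z.2‖}.indicator (fun z ↦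
        (‖z.1‖ : ℂ) ^ α * (‖z.2‖ : ℂ) ^ β *
          (θ (-z.1) * θ (-(fiberCenter z.1 z.2 ^ 2 / z.2)))) (x, a) ∂μ =
      {x : ℚ_[p] | p ≤ ‖x‖}.indicator (fun x ↦ g ‖x‖ * θ (-x)) x := by
    by_cases hx : p ≤ ‖x‖
    · rw [Set.indicator_of_mem (show x ∈ {x : ℚ_[p] | p ≤ ‖x‖} from hx)]
      simp only [g]
      rw [← integral_fiber_character hμ hθ hθ_add hθ_unit hθ_triv ht hθt hβ hx, mul_right_comm,
        ← integral_const_mul]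
      congr 1 with a
      simp only [Set.indicator_apply, Set.mem_ofPred_eq, hx, true_and, mul_ite, mul_zero]
      congr 1
      ring
    · simp [hx]
  simp_rw [hinner] at hH' ⊢
  rw [integral_norm_mul_character hμ hθ hθ_add hθ_unit hθ_triv ht hθt hH']
  simp only [g]
  rw [integral_indicator_annulus hμ, measureReal_norm_le_pow hμ]
  have h2 : ((p : ℂ) ^ 2) ^ β = ((p : ℂ) ^ β) ^ 2 := by
    rw [sq, Complex.natCast_mul_natCast_cpow, sq]
  have h3 : ((p * p ^ 2 : ℝ) : ℂ) ^ β = ((p : ℂ) ^ β) ^ 3 := by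
    have := Complex.natCast_mul_natCast_cpow p (p ^ 2) β
    push_cast at this ⊢
    rw [this, h2]
    ring
  rw [h2, h3]
  push_cast
  ring

/-- The coordinates `(((x, a), u), w)` straightening the region to a product. -/
noncomputable def straighten (z : ((ℚ_[p] × ℚ_[p]) × ℚ_[p]) × ℚ_[p]) :
    ℚ_[p] × ℚ_[p] × ℚ_[p] × ℚ_[p] :=
  (z.1.1.2, z.1.2 + fiberCenter z.1.1.1 z.1.1.2,
    z.2 + (z.1.2 + fiberCenter z.1.1.1 z.1.1.2) ^ 2 / z.1.1.2, z.1.1.1)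

theorem measurePreserving_straighten [SigmaFinite μ] :
    MeasurePreserving straighten (((μ.prod μ).prod μ).prod μ)
      (μ.prod (μ.prod (μ.prod μ))) := by
  have hs := measurable_fiberCenter (p := p)
  have h1 : MeasurePreserving (fun z : (ℚ_[p] × ℚ_[p]) × ℚ_[p] ↦
      (z.1, z.2 + fiberCenter z.1.1 z.1.2)) ((μ.prod μ).prod μ) ((μ.prod μ).prod μ) :=
    (MeasurePreserving.id (μ.prod μ)).skew_product (g := fun z u ↦ u + fiberCenter z.1 z.2)
      (measurable_snd.add (hs.comp measurable_fst)) (ae_of_all _ fun z ↦ map_add_right_eq_self μ _)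
  have h2 : MeasurePreserving (fun z : ((ℚ_[p] × ℚ_[p]) × ℚ_[p]) × ℚ_[p] ↦
      ((z.1.1, z.1.2 + fiberCenter z.1.1.1 z.1.1.2),
        z.2 + (z.1.2 + fiberCenter z.1.1.1 z.1.1.2) ^ 2 / z.1.1.2))
      (((μ.prod μ).prod μ).prod μ) (((μ.prod μ).prod μ).prod μ) :=
    h1.skew_product (g := fun z w ↦ w + (z.2 + fiberCenter z.1.1 z.1.2) ^ 2 / z.1.2)
      (by unfold Function.uncurry; fun_prop) (ae_of_all _ fun z ↦ map_add_right_eq_self μ _)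
  have h3 : MeasurePreserving (fun z : ((ℚ_[p] × ℚ_[p]) × ℚ_[p]) × ℚ_[p] ↦
      ((z.1.1.1, (z.1.1.2, (z.1.2, z.2))) : ℚ_[p] × ℚ_[p] × ℚ_[p] × ℚ_[p]))
      (((μ.prod μ).prod μ).prod μ) (μ.prod (μ.prod (μ.prod μ))) :=
    (measurePreserving_prodAssoc μ μ (μ.prod μ)).comp
      (measurePreserving_prodAssoc (μ.prod μ) μ μ)
  have h4 : MeasurePreserving (fun z : ℚ_[p] × ℚ_[p] × ℚ_[p] × ℚ_[p] ↦
      ((z.2.1, (z.2.2, z.1)) : ℚ_[p] × (ℚ_[p] × ℚ_[p]) × ℚ_[p]))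
      (μ.prod (μ.prod (μ.prod μ))) (μ.prod ((μ.prod μ).prod μ)) :=
    (measurePreserving_prodAssoc μ (μ.prod μ) μ).comp Measure.measurePreserving_swap
  have h5 : MeasurePreserving (fun z : ℚ_[p] × (ℚ_[p] × ℚ_[p]) × ℚ_[p] ↦
      ((z.1, z.2.1.1, z.2.1.2, z.2.2) : ℚ_[p] × ℚ_[p] × ℚ_[p] × ℚ_[p]))
      (μ.prod ((μ.prod μ).prod μ)) (μ.prod (μ.prod (μ.prod μ))) :=
    (MeasurePreserving.id μ).prod (measurePreserving_prodAssoc μ μ μ)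
  exact h5.comp (h4.comp (h3.comp h2))

end

/-- For `Re(ν₂)` and `Re(ν₁−ν₂)` large enough, with `(a,b,c,x) = q`,
the function `|x|^{−1−ν₁+ν₂}·|a|^{−1−ν₂}·θ(−x−c)` is absolutely integrable on
`R = {v(a) ≤ min{−1, v(b)−1, v(ac−b²)}, v(x) ≤ v(a+bx)}` and its integral equals
`p^{−2−ν₁−2ν₂} − (1−p⁻¹)p^{−1−ν₁} − (1−p⁻¹)p^{−1−ν₁−ν₂}`. -/
theorem stmt_18 (p : ℕ) [Fact p.Prime]
    [MeasurableSpace ℚ_[p]] [BorelSpace ℚ_[p]]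
    (μ : Measure ℚ_[p]) [SigmaFinite μ]
    (hμ_inv : ∀ a : ℚ_[p], μ.map (a + ·) = μ)
    (hμ_norm : μ {x : ℚ_[p] | ‖x‖ ≤ 1} = 1)
    (θ : ℚ_[p] → ℂ) (hθ_cont : Continuous θ)
    (hθ_add : ∀ a b : ℚ_[p], θ (a + b) = θ a * θ b)
    (hθ_unit : ∀ a : ℚ_[p], ‖θ a‖ = 1)
    (hθ_triv : ∀ a : ℚ_[p], ‖a‖ ≤ 1 → θ a = 1)
    (hθ_nontriv : ∃ a : ℚ_[p], ‖a‖ ≤ (p : ℝ) ∧ θ a ≠ 1) :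
    ∃ T : ℝ, ∀ ν₁ ν₂ : ℂ, T < ν₂.re → T < (ν₁ - ν₂).re →
      IntegrableOn
        (fun q : ℚ_[p] × ℚ_[p] × ℚ_[p] × ℚ_[p] =>
          (‖q.2.2.2‖ : ℂ) ^ (-1 - ν₁ + ν₂) *
            (‖q.1‖ : ℂ) ^ (-1 - ν₂) * θ (-q.2.2.2 - q.2.2.1))
        {q : ℚ_[p] × ℚ_[p] × ℚ_[p] × ℚ_[p] | Padic.addValuation q.1 ≤
            min ((-1 : ℤ) : WithTop ℤ)
              (min (Padic.addValuation q.2.1 - 1)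
                (Padic.addValuation (q.1 * q.2.2.1 - q.2.1 ^ 2))) ∧
          Padic.addValuation q.2.2.2 ≤ Padic.addValuation (q.1 + q.2.1 * q.2.2.2)}
        (μ.prod (μ.prod (μ.prod μ))) ∧
      ∫ q in {q : ℚ_[p] × ℚ_[p] × ℚ_[p] × ℚ_[p] | Padic.addValuation q.1 ≤
            min ((-1 : ℤ) : WithTop ℤ)
              (min (Padic.addValuation q.2.1 - 1)
                (Padic.addValuation (q.1 * q.2.2.1 - q.2.1 ^ 2))) ∧
          Padic.addValuation q.2.2.2 ≤ Padic.addValuation (q.1 + q.2.1 * q.2.2.2)},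
          (‖q.2.2.2‖ : ℂ) ^ (-1 - ν₁ + ν₂) *
            (‖q.1‖ : ℂ) ^ (-1 - ν₂) * θ (-q.2.2.2 - q.2.2.1)
          ∂(μ.prod (μ.prod (μ.prod μ))) =
        (p : ℂ) ^ (-2 - ν₁ - 2 * ν₂) -
          (1 - (p : ℂ)⁻¹) * (p : ℂ) ^ (-1 - ν₁) -
          (1 - (p : ℂ)⁻¹) * (p : ℂ) ^ (-1 - ν₁ - ν₂) := by
  have hp : (1 : ℝ) < p := mod_cast (Fact.out : p.Prime).one_lt
  have hp0 : (p : ℂ) ≠ 0 := mod_cast (Fact.out : p.Prime).ne_zero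
  have : μ.IsAddLeftInvariant := ⟨hμ_inv⟩
  have hθ := hθ_cont.measurable
  obtain ⟨t, ht, hθt'⟩ := hθ_nontriv
  have hθt : θ (-t) ≠ 1 := fun h ↦ hθt' <| by
    have := hθ_add t (-t)
    rwa [h, mul_one, add_neg_cancel, hθ_triv 0 (by simp), eq_comm] at this
  have hs := measurable_fiberCenter (p := p)
  refine ⟨1, fun ν₁ ν₂ h₂ h₁ ↦ ?_⟩
  simp only [mem_region_iff]
  set α := -1 - ν₁ + ν₂ with hαdef
  set β := -1 - ν₂ with hβdef
  have hα : α.re ≤ -2 := by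
    simp only [Complex.sub_re] at h₁
    simp only [hαdef, Complex.add_re, Complex.sub_re, Complex.neg_re, Complex.one_re]
    linarith
  have hβ : β.re ≤ -2 := by
    simp only [hβdef, Complex.sub_re, Complex.neg_re, Complex.one_re]
    linarith
  set R : Set (ℚ_[p] × ℚ_[p] × ℚ_[p] × ℚ_[p]) := {q | (p ≤ ‖q.2.2.2‖ ∧ p ≤ ‖q.1‖) ∧
    ‖q.2.1 - fiberCenter q.2.2.2 q.1‖ ≤ 1 ∧ ‖q.2.2.1 - q.2.1 ^ 2 / q.1‖ ≤ 1}
  have hR : MeasurableSet R := by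
    simp only [R, Set.ofPred_and]
    exact ((measurableSet_le (by fun_prop) (by fun_prop)).inter
      (measurableSet_le (by fun_prop) (by fun_prop))).inter
      ((measurableSet_le (by fun_prop) (by fun_prop)).inter
        (measurableSet_le (by fun_prop) (by fun_prop)))
  set f : ℚ_[p] × ℚ_[p] × ℚ_[p] × ℚ_[p] → ℂ := fun q ↦
    (‖q.2.2.2‖ : ℂ) ^ α * (‖q.1‖ : ℂ) ^ β * θ (-q.2.2.2 - q.2.2.1)
  have hf : Measurable (R.indicator f) := Measurable.indicator (by fun_prop) hR
  let χ : ℚ_[p] → ℂ := {u : ℚ_[p] | ‖u‖ ≤ 1}.indicator fun _ ↦ 1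
  have hχ : Integrable χ μ := integrable_indicator_norm_le hμ_norm (by fun_prop) (by simp) _
  have hχi : ∫ u, χ u ∂μ = 1 := by
    rw [integral_indicator_norm_le_one, measureReal_def, hμ_norm]
    simp
  let H : ℚ_[p] × ℚ_[p] → ℂ := {z : ℚ_[p] × ℚ_[p] | p ≤ ‖z.1‖ ∧ p ≤ ‖z.2‖}.indicator fun z ↦
    (‖z.1‖ : ℂ) ^ α * (‖z.2‖ : ℂ) ^ β * (θ (-z.1) * θ (-(fiberCenter z.1 z.2 ^ 2 / z.2)))
  have hH : Integrable H (μ.prod μ) := integrable_straightened_integrand hμ_norm hθ hθ_unit hα hβ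
  have hcomp : R.indicator f ∘ straighten = fun z ↦ H z.1.1 * χ z.1.2 * χ z.2 := by
    funext ⟨⟨⟨x, a⟩, u⟩, w⟩
    simp only [Function.comp_apply, straighten, R, f, H, χ, Set.indicator_apply,
      Set.mem_ofPred_eq, add_sub_cancel_right]
    by_cases h : p ≤ ‖x‖ ∧ p ≤ ‖a‖
    swap
    · simp [h]
    by_cases hu : ‖u‖ ≤ 1
    swap
    · simp [hu]
    by_cases hw : ‖w‖ ≤ 1
    swap
    · simp [hw]
    simp only [h, hu, hw, and_self, if_true, mul_one]
    rw [character_eq_on_region hθ_add hθ_triv h.1 h.2 hu hw]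
  have hΨ := measurePreserving_straighten (μ := μ)
  have hHχ := (hH.mul_prod hχ).mul_prod hχ
  constructor
  · rw [← integrable_indicator_iff hR, ← hΨ.integrable_comp hf.aestronglyMeasurable, hcomp]
    exact hHχ
  · rw [← integral_indicator hR, ← hΨ.map_eq,
      integral_map hΨ.aemeasurable hf.aestronglyMeasurable]
    change ∫ z, (R.indicator f ∘ straighten) z ∂_ = _
    rw [hcomp, integral_prod_mul (fun z : (ℚ_[p] × ℚ_[p]) × ℚ_[p] ↦ H z.1 * χ z.2) χ,
      integral_prod_mul H χ, hχi, mul_one, mul_one,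
      integral_straightened_integrand hμ_norm hθ hθ_add hθ_unit hθ_triv ht hθt hα hβ,
      show -2 - ν₁ - 2 * ν₂ = α + (β + β + β) + 2 by rw [hαdef, hβdef]; ring,
      show -1 - ν₁ = α + β + 1 by rw [hαdef, hβdef]; ring,
      show α + β + 1 - ν₂ = α + (β + β) + 2 by rw [hαdef, hβdef]; ring]
    simp only [Complex.cpow_add _ _ hp0, Complex.cpow_one, Complex.cpow_ofNat]
    field_simp
end

section
/- Let p be a prime and θ as below. Let R = { (a,b,c,x) ∈ ℚ_p⁴ : v_p(c) ≤ min{−1, v_p(b), v_p(ac − b²)} and v_p(b + cx) < 0 } (so in particular c ≠ 0 and b + cx ≠ 0 on R). There exists T ∈ ℝ such that for all ν₁, ν₂ ∈ ℂ with Re(ν₂) > T and Re(ν₁ − ν₂) > T, the function (a,b,c,x) ↦ |b + cx|^{−1−ν₁+ν₂} · |c|^{−1−ν₂} · θ(−x − c) is absolutely integrable on R and ∫_R |b + cx|^{−1−ν₁+ν₂} |c|^{−1−ν₂} θ(−x − c) da db dc dx = p^{−2−2ν₁+ν₂} − (1 − p⁻¹)·p^{−1−ν₁}. -/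
open MeasureTheory

namespace Padic
variable {p : ℕ} [Fact p.Prime]

theorem closedBall_zpow_succ (k : ℤ) :
    Metric.closedBall (0 : ℚ_[p]) ((p : ℝ) ^ (k + 1)) =
      ⋃ i ∈ Finset.range p,
        Metric.closedBall ((i : ℚ_[p]) * (p : ℚ_[p]) ^ (-(k + 1))) ((p : ℝ) ^ k) := by
  have hp0 : (0 : ℝ) < p := mod_cast (Fact.out : p.Prime).pos
  have hp1 : (p : ℚ_[p]) ≠ 0 := mod_cast (Fact.out : p.Prime).ne_zero
  ext x
  rw [mem_closedBall_zero_iff]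
  simp only [Set.mem_iUnion, Finset.mem_range, mem_closedBall_iff_norm, exists_prop]
  constructor
  · intro hx
    have hy : ‖x * (p : ℚ_[p]) ^ (k + 1)‖ ≤ 1 := by
      rw [norm_mul, Padic.norm_p_zpow, zpow_neg, ← div_eq_mul_inv]
      exact div_le_one_of_le₀ hx (by positivity)
    obtain ⟨y, hxy⟩ : ∃ y : ℤ_[p], (y : ℚ_[p]) = x * (p : ℚ_[p]) ^ (k + 1) := ⟨⟨_, hy⟩, rfl⟩
    obtain ⟨i, hi, hm⟩ := PadicInt.exists_mem_range y
    refine ⟨i, hi, ?_⟩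
    rw [PadicInt.maximalIdeal_eq_span_p, Ideal.mem_span_singleton, ← PadicInt.norm_lt_one_iff_dvd,
      PadicInt.norm_def, PadicInt.coe_sub, PadicInt.coe_natCast, hxy] at hm
    have h2 : x - i * (p : ℚ_[p]) ^ (-(k + 1)) =
        (x * (p : ℚ_[p]) ^ (k + 1) - i) * (p : ℚ_[p]) ^ (-(k + 1)) := by
      rw [sub_mul, mul_assoc, ← zpow_add₀ hp1]; simp
    rw [Padic.norm_le_pow_iff_norm_lt_pow_add_one, h2, norm_mul, Padic.norm_p_zpow, neg_neg]
    exact mul_lt_of_lt_one_left (by positivity) hm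
  · rintro ⟨i, hi, hx⟩
    have h1 : ‖(i : ℚ_[p]) * (p : ℚ_[p]) ^ (-(k + 1))‖ ≤ (p : ℝ) ^ (k + 1) := by
      rw [norm_mul, Padic.norm_p_zpow, neg_neg]
      exact mul_le_of_le_one_left (by positivity) (mod_cast Padic.norm_int_le_one (i : ℤ))
    have h2 : (p : ℝ) ^ k ≤ (p : ℝ) ^ (k + 1) :=
      zpow_le_zpow_right₀ (mod_cast (Fact.out : p.Prime).one_le) (by lia)
    have := Padic.nonarchimedean (x - (i : ℚ_[p]) * (p : ℚ_[p]) ^ (-(k + 1)))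
      ((i : ℚ_[p]) * (p : ℚ_[p]) ^ (-(k + 1)))
    rw [sub_add_cancel] at this
    exact this.trans (max_le (hx.trans h2) h1)

theorem pairwiseDisjoint_closedBall_zpow (k : ℤ) :
    ((Finset.range p : Finset ℕ) : Set ℕ).PairwiseDisjoint fun i : ℕ ↦
      Metric.closedBall ((i : ℚ_[p]) * (p : ℚ_[p]) ^ (-(k + 1))) ((p : ℝ) ^ k) := by
  have hp0 : (0 : ℝ) < p := mod_cast (Fact.out : p.Prime).pos
  intro i hi j hj hij
  rw [Function.onFun, Set.disjoint_left]
  intro x hxi hxj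
  apply hij
  rw [mem_closedBall_iff_norm] at hxi hxj
  rw [norm_sub_rev] at hxi
  have := (Padic.nonarchimedean _ _).trans (max_le hxi hxj)
  rw [sub_add_sub_cancel, ← sub_mul, Padic.norm_le_pow_iff_norm_lt_pow_add_one, norm_mul,
    Padic.norm_p_zpow, neg_neg, mul_lt_iff_lt_one_left (by positivity)] at this
  have h2 : ‖(((i : ℤ) - j : ℤ) : ℚ_[p])‖ < 1 := by push_cast; exact this
  rw [Padic.norm_intCast_lt_one_iff] at h2
  simp only [Finset.coe_range, Set.mem_Iio] at hi hj
  have := Int.eq_zero_of_abs_lt_dvd h2 (by rw [abs_lt]; lia)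
  lia

theorem sphere_eq_diff (k : ℤ) :
    Metric.sphere (0 : ℚ_[p]) ((p : ℝ) ^ k) = Metric.closedBall (0 : ℚ_[p]) ((p : ℝ) ^ k) \
      Metric.closedBall (0 : ℚ_[p]) ((p : ℝ) ^ (k - 1)) := by
  ext x
  have := Padic.norm_lt_pow_iff_norm_le_pow_sub_one x k
  simp only [mem_sphere_zero_iff_norm, Set.mem_sdiff, mem_closedBall_zero_iff, ← this, not_lt]
  exact le_antisymm_iff

theorem closedBall_zpow_sub_one_subset (k : ℤ) :
    Metric.closedBall (0 : ℚ_[p]) ((p : ℝ) ^ (k - 1)) ⊆ Metric.closedBall 0 ((p : ℝ) ^ k) :=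
  Metric.closedBall_subset_closedBall
    (zpow_le_zpow_right₀ (mod_cast (Fact.out : p.Prime).one_le) (by lia))

theorem iUnion_sphere_zpow_add (m : ℤ) :
    ⋃ j : ℕ, Metric.sphere (0 : ℚ_[p]) ((p : ℝ) ^ (m + j)) = {x | (p : ℝ) ^ m ≤ ‖x‖} := by
  have hp1 : (1 : ℝ) < p := mod_cast (Fact.out : p.Prime).one_lt
  ext x
  simp only [Set.mem_iUnion, mem_sphere_zero_iff_norm, Set.mem_ofPred_eq]
  constructor
  · rintro ⟨j, hj⟩
    rw [hj]
    exact zpow_le_zpow_right₀ hp1.le (by lia)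
  · intro hx
    have hx0 : x ≠ 0 := by
      rintro rfl
      rw [norm_zero] at hx
      exact (zpow_pos (by linarith) m).not_ge hx
    rw [Padic.norm_eq_zpow_neg_valuation hx0] at hx ⊢
    rw [zpow_le_zpow_iff_right₀ hp1] at hx
    exact ⟨(-x.valuation - m).toNat, by congr 1; lia⟩

theorem pairwise_disjoint_sphere_zpow_add (m : ℤ) :
    Pairwise (Function.onFun Disjoint fun j : ℕ ↦
      Metric.sphere (0 : ℚ_[p]) ((p : ℝ) ^ (m + j))) := by
  intro i j hij
  rw [Function.onFun, Set.disjoint_left]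
  intro x hi hj
  rw [mem_sphere_zero_iff_norm] at hi hj
  have := zpow_right_injective₀ (by exact_mod_cast (Fact.out : p.Prime).pos)
    (by exact_mod_cast (Fact.out : p.Prime).ne_one) (hi.symm.trans hj)
  lia

theorem zpow_rpow_neg_one_sub_mul (σ : ℝ) (k : ℤ) :
    ((p : ℝ) ^ k) ^ (-1 - σ) * (p : ℝ) ^ k = ((p : ℝ) ^ (-σ)) ^ k := by
  have hp0 : (0 : ℝ) < p := mod_cast (Fact.out : p.Prime).pos
  simp only [← Real.rpow_intCast]
  rw [← Real.rpow_mul hp0.le, ← Real.rpow_add hp0, ← Real.rpow_mul hp0.le]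
  ring_nf

theorem summable_rpow_neg_zpow_add {σ : ℝ} (hσ : 0 < σ) (m : ℤ) (C : ℝ) :
    Summable fun j : ℕ ↦ ((p : ℝ) ^ (-σ)) ^ (m + j) * C := by
  have hp1 : (1 : ℝ) < p := mod_cast (Fact.out : p.Prime).one_lt
  have hr : (0 : ℝ) < (p : ℝ) ^ (-σ) := by positivity
  simp only [zpow_add₀ hr.ne', zpow_natCast]
  exact ((summable_geometric_of_lt_one hr.le
    (Real.rpow_lt_one_of_one_lt_of_neg hp1 (by linarith))).mul_left _).mul_right _

section

variable [MeasurableSpace ℚ_[p]] [BorelSpace ℚ_[p]] (μ : Measure ℚ_[p])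

theorem isFiniteMeasureOnCompacts_of_closedBall [μ.IsAddLeftInvariant]
    (h1 : μ {x : ℚ_[p] | ‖x‖ ≤ 1} = 1) : IsFiniteMeasureOnCompacts μ := by
  refine ⟨fun K hK ↦ measure_lt_top_of_isCompact_of_isAddLeftInvariant (Metric.ball 0 1)
    Metric.isOpen_ball (by simp) (ne_top_of_le_ne_top (by simp)
      ((measure_mono fun x hx ↦ ?_).trans_eq h1)) hK⟩
  exact (mem_ball_zero_iff.1 hx).le

theorem measureReal_closedBall_zpow [μ.IsAddLeftInvariant]
    (h1 : μ {x : ℚ_[p] | ‖x‖ ≤ 1} = 1) (k : ℤ) :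
    μ.real (Metric.closedBall (0 : ℚ_[p]) ((p : ℝ) ^ k)) = (p : ℝ) ^ k := by
  have hp0 : (p : ℝ) ≠ 0 := mod_cast (Fact.out : p.Prime).ne_zero
  have h0 : μ.real (Metric.closedBall (0 : ℚ_[p]) ((p : ℝ) ^ (0 : ℤ))) = 1 := by
    rw [Measure.real, ← ENNReal.toReal_one, ← h1, zpow_zero]
    congr 2; ext; simp
  have hs (k : ℤ) : μ.real (Metric.closedBall (0 : ℚ_[p]) ((p : ℝ) ^ (k + 1))) =
      p * μ.real (Metric.closedBall (0 : ℚ_[p]) ((p : ℝ) ^ k)) := by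
    rw [closedBall_zpow_succ, Measure.real, measure_biUnion_finset
      (pairwiseDisjoint_closedBall_zpow k) fun i _ ↦ Metric.isClosed_closedBall.measurableSet]
    have (i : ℕ) : μ (Metric.closedBall ((i : ℚ_[p]) * (p : ℚ_[p]) ^ (-(k + 1))) ((p : ℝ) ^ k)) =
        μ (Metric.closedBall 0 ((p : ℝ) ^ k)) := by
      rw [← measure_preimage_add μ ((i : ℚ_[p]) * (p : ℚ_[p]) ^ (-(k + 1)))
        (Metric.closedBall _ _), preimage_add_closedBall, sub_self]
    simp_rw [this]
    simp [Measure.real]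
  induction k using Int.induction_on with
  | zero => simpa using h0
  | succ n ih => rw [hs, ih, zpow_add_one₀ hp0, mul_comm]
  | pred n ih =>
    have := hs (-n - 1)
    rw [sub_add_cancel, ih] at this
    refine mul_left_cancel₀ hp0 (this.symm.trans ?_)
    rw [zpow_sub_one₀ hp0, mul_comm, inv_mul_cancel_right₀ hp0]

theorem measureReal_sphere_zpow [μ.IsAddLeftInvariant]
    (h1 : μ {x : ℚ_[p] | ‖x‖ ≤ 1} = 1) (k : ℤ) :
    μ.real (Metric.sphere (0 : ℚ_[p]) ((p : ℝ) ^ k)) = (p : ℝ) ^ k * (1 - (p : ℝ)⁻¹) := by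
  have := isFiniteMeasureOnCompacts_of_closedBall μ h1
  have hp0 : (p : ℝ) ≠ 0 := mod_cast (Fact.out : p.Prime).ne_zero
  rw [sphere_eq_diff, measureReal_sdiff (closedBall_zpow_sub_one_subset k)
    Metric.isClosed_closedBall.measurableSet (isCompact_closedBall _ _).measure_ne_top,
    measureReal_closedBall_zpow μ h1, measureReal_closedBall_zpow μ h1, zpow_sub_one₀ hp0]
  ring

variable {θ : ℚ_[p] → ℂ}

theorem setIntegral_closedBall_neg_eq_zero [μ.IsAddLeftInvariant]
    (hθ_add : ∀ a b : ℚ_[p], θ (a + b) = θ a * θ b)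
    (hθ_triv : ∀ a : ℚ_[p], ‖a‖ ≤ 1 → θ a = 1)
    (hθ_nontriv : ∃ a : ℚ_[p], ‖a‖ ≤ (p : ℝ) ∧ θ a ≠ 1) {k : ℤ} (hk : 1 ≤ k) :
    ∫ x in Metric.closedBall (0 : ℚ_[p]) ((p : ℝ) ^ k), θ (-x) ∂μ = 0 := by
  obtain ⟨a, ha, hθa⟩ := hθ_nontriv
  set B := Metric.closedBall (0 : ℚ_[p]) ((p : ℝ) ^ k)
  have haB : ‖a‖ ≤ (p : ℝ) ^ k := ha.trans (by
    simpa using zpow_le_zpow_right₀ (mod_cast (Fact.out : p.Prime).one_le : (1 : ℝ) ≤ p) hk)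
  have hmem (x : ℚ_[p]) : a + x ∈ B ↔ x ∈ B := by
    simp only [B, mem_closedBall_zero_iff]
    constructor <;> intro h
    · have := (Padic.nonarchimedean (-a) (a + x)).trans (max_le (by rwa [norm_neg]) h)
      simpa using this
    · exact (Padic.nonarchimedean _ _).trans (max_le haB h)
  have h1 : ∫ x in B, θ (-x) ∂μ = θ (-a) * ∫ x in B, θ (-x) ∂μ := by
    have hB : MeasurableSet B := Metric.isClosed_closedBall.measurableSet
    rw [← integral_const_mul, ← integral_indicator hB, ← integral_indicator hB,
      ← integral_add_left_eq_self _ a]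
    congr 1 with x
    by_cases hx : x ∈ B <;> simp [Set.indicator, hmem, ← hθ_add, hx, add_comm]
  have h2 : θ (-a) ≠ 1 := fun h ↦ hθa (by
    have := hθ_add a (-a)
    rwa [add_neg_cancel, h, mul_one, hθ_triv 0 (by simp), eq_comm] at this)
  have h3 : (1 - θ (-a)) * ∫ x in B, θ (-x) ∂μ = 0 := by linear_combination h1
  exact (mul_eq_zero.1 h3).resolve_left (sub_ne_zero.2 h2.symm)

theorem setIntegral_closedBall_neg_of_nonpos [μ.IsAddLeftInvariant]
    (h1 : μ {x : ℚ_[p] | ‖x‖ ≤ 1} = 1)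
    (hθ_triv : ∀ a : ℚ_[p], ‖a‖ ≤ 1 → θ a = 1) {k : ℤ} (hk : k ≤ 0) :
    ∫ x in Metric.closedBall (0 : ℚ_[p]) ((p : ℝ) ^ k), θ (-x) ∂μ = (p : ℂ) ^ k := by
  rw [setIntegral_congr_fun (g := fun _ ↦ (1 : ℂ)) Metric.isClosed_closedBall.measurableSet]
  · rw [setIntegral_const, measureReal_closedBall_zpow μ h1]; simp
  · intro x hx
    refine hθ_triv _ ?_
    rw [norm_neg]
    exact (mem_closedBall_zero_iff.1 hx).trans
      (zpow_le_one_of_nonpos₀ (mod_cast (Fact.out : p.Prime).one_le) hk)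

theorem setIntegral_sphere_neg [IsFiniteMeasureOnCompacts μ] (hθ_cont : Continuous θ) (k : ℤ) :
    ∫ x in Metric.sphere (0 : ℚ_[p]) ((p : ℝ) ^ k), θ (-x) ∂μ =
      (∫ x in Metric.closedBall (0 : ℚ_[p]) ((p : ℝ) ^ k), θ (-x) ∂μ) -
      ∫ x in Metric.closedBall (0 : ℚ_[p]) ((p : ℝ) ^ (k - 1)), θ (-x) ∂μ := by
  rw [sphere_eq_diff, setIntegral_sdiff (f := fun x ↦ θ (-x)) Metric.isClosed_closedBall.measurableSet
    ((hθ_cont.comp continuous_neg).continuousOn.integrableOn_compact (isCompact_closedBall _ _))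
    (closedBall_zpow_sub_one_subset k)]

theorem setIntegral_sphere_norm_cpow_mul (s : ℂ) (k : ℤ) :
    ∫ x in Metric.sphere (0 : ℚ_[p]) ((p : ℝ) ^ k), (‖x‖ : ℂ) ^ s * θ (-x) ∂μ =
      (((p : ℝ) ^ k : ℝ) : ℂ) ^ s *
        ∫ x in Metric.sphere (0 : ℚ_[p]) ((p : ℝ) ^ k), θ (-x) ∂μ := by
  rw [← integral_const_mul]
  refine setIntegral_congr_fun Metric.isClosed_sphere.measurableSet fun x hx ↦ ?_
  simp only [mem_sphere_zero_iff_norm.1 hx]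

theorem setIntegral_sphere_norm_norm_cpow_mul [μ.IsAddLeftInvariant]
    (h1 : μ {x : ℚ_[p] | ‖x‖ ≤ 1} = 1) (hθ_unit : ∀ a : ℚ_[p], ‖θ a‖ = 1) (s : ℂ) (k : ℤ) :
    ∫ x in Metric.sphere (0 : ℚ_[p]) ((p : ℝ) ^ k), ‖(‖x‖ : ℂ) ^ (-1 - s) * θ (-x)‖ ∂μ =
      ((p : ℝ) ^ (-s.re)) ^ k * (1 - (p : ℝ)⁻¹) := by
  have hp0 : (0 : ℝ) < p := mod_cast (Fact.out : p.Prime).pos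
  rw [setIntegral_congr_fun (g := fun _ ↦ ((p : ℝ) ^ k) ^ (-1 - s.re))
    Metric.isClosed_sphere.measurableSet]
  · rw [setIntegral_const, measureReal_sphere_zpow μ h1, ← zpow_rpow_neg_one_sub_mul, smul_eq_mul]
    ring
  · intro x hx
    have hx' := mem_sphere_zero_iff_norm.1 hx
    simp only [norm_mul, hθ_unit, mul_one, hx']
    rw [Complex.norm_cpow_eq_rpow_re_of_pos (by positivity)]
    simp

theorem integrableOn_sphere_norm_cpow_mul [IsFiniteMeasureOnCompacts μ]
    (hθ_cont : Continuous θ) (s : ℂ) (k : ℤ) :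
    IntegrableOn (fun x : ℚ_[p] ↦ (‖x‖ : ℂ) ^ s * θ (-x))
      (Metric.sphere (0 : ℚ_[p]) ((p : ℝ) ^ k)) μ := by
  have : IntegrableOn (fun x : ℚ_[p] ↦ (((p : ℝ) ^ k : ℝ) : ℂ) ^ s * θ (-x))
      (Metric.sphere (0 : ℚ_[p]) ((p : ℝ) ^ k)) μ :=
    ((by fun_prop : Continuous fun x : ℚ_[p] ↦ (((p : ℝ) ^ k : ℝ) : ℂ) ^ s *
      θ (-x)).continuousOn.integrableOn_compact (isCompact_sphere _ _))
  refine this.congr_fun (fun x hx ↦ ?_) Metric.isClosed_sphere.measurableSet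
  simp only [mem_sphere_zero_iff_norm.1 hx]

theorem integrableOn_norm_cpow_mul [μ.IsAddLeftInvariant]
    (h1 : μ {x : ℚ_[p] | ‖x‖ ≤ 1} = 1) (hθ_cont : Continuous θ)
    (hθ_unit : ∀ a : ℚ_[p], ‖θ a‖ = 1) {s : ℂ} (hs : 0 < s.re) (m : ℤ) :
    IntegrableOn (fun x : ℚ_[p] ↦ (‖x‖ : ℂ) ^ (-1 - s) * θ (-x)) {x | (p : ℝ) ^ m ≤ ‖x‖} μ := by
  have := isFiniteMeasureOnCompacts_of_closedBall μ h1
  rw [← iUnion_sphere_zpow_add]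
  refine integrableOn_iUnion_of_summable_integral_norm
    (fun j ↦ integrableOn_sphere_norm_cpow_mul μ hθ_cont _ _) ?_
  simp only [setIntegral_sphere_norm_norm_cpow_mul μ h1 hθ_unit]
  exact summable_rpow_neg_zpow_add hs m _

theorem setIntegral_norm_norm_cpow_mul [μ.IsAddLeftInvariant]
    (h1 : μ {x : ℚ_[p] | ‖x‖ ≤ 1} = 1) (hθ_cont : Continuous θ)
    (hθ_unit : ∀ a : ℚ_[p], ‖θ a‖ = 1) {s : ℂ} (hs : 0 < s.re) (m : ℤ) :
    ∫ x in {x | (p : ℝ) ^ m ≤ ‖x‖}, ‖(‖x‖ : ℂ) ^ (-1 - s) * θ (-x)‖ ∂μ =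
      ((p : ℝ) ^ (-s.re)) ^ m *
        ∑' j : ℕ, ((p : ℝ) ^ (-s.re)) ^ j * (1 - (p : ℝ)⁻¹) := by
  have hp0 : (0 : ℝ) < p := mod_cast (Fact.out : p.Prime).pos
  have hi := (integrableOn_norm_cpow_mul μ h1 hθ_cont hθ_unit hs m).norm
  rw [← iUnion_sphere_zpow_add] at hi ⊢
  have h := hasSum_integral_iUnion (fun j ↦ Metric.isClosed_sphere.measurableSet)
    (pairwise_disjoint_sphere_zpow_add m) hi
  rw [← h.tsum_eq, ← tsum_mul_left]
  refine tsum_congr fun j ↦ ?_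
  rw [setIntegral_sphere_norm_norm_cpow_mul μ h1 hθ_unit, zpow_add₀ (by positivity), zpow_natCast,
    mul_assoc]

variable [μ.IsAddLeftInvariant] (h1 : μ {x : ℚ_[p] | ‖x‖ ≤ 1} = 1) (hθ_cont : Continuous θ)
  (hθ_add : ∀ a b : ℚ_[p], θ (a + b) = θ a * θ b) (hθ_unit : ∀ a : ℚ_[p], ‖θ a‖ = 1)
  (hθ_triv : ∀ a : ℚ_[p], ‖a‖ ≤ 1 → θ a = 1)
  (hθ_nontriv : ∃ a : ℚ_[p], ‖a‖ ≤ (p : ℝ) ∧ θ a ≠ 1)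
include h1 hθ_cont hθ_add hθ_triv hθ_nontriv

theorem setIntegral_sphere_neg_one :
    ∫ x in Metric.sphere (0 : ℚ_[p]) ((p : ℝ) ^ (1 : ℤ)), θ (-x) ∂μ = -1 := by
  have := isFiniteMeasureOnCompacts_of_closedBall μ h1
  rw [setIntegral_sphere_neg μ hθ_cont,
    setIntegral_closedBall_neg_eq_zero μ hθ_add hθ_triv hθ_nontriv le_rfl,
    setIntegral_closedBall_neg_of_nonpos μ h1 hθ_triv (by simp)]
  simp

theorem setIntegral_sphere_neg_of_two_le {k : ℤ} (hk : 2 ≤ k) :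
    ∫ x in Metric.sphere (0 : ℚ_[p]) ((p : ℝ) ^ k), θ (-x) ∂μ = 0 := by
  have := isFiniteMeasureOnCompacts_of_closedBall μ h1
  rw [setIntegral_sphere_neg μ hθ_cont,
    setIntegral_closedBall_neg_eq_zero μ hθ_add hθ_triv hθ_nontriv (by lia),
    setIntegral_closedBall_neg_eq_zero μ hθ_add hθ_triv hθ_nontriv (by lia), sub_zero]

include hθ_unit in
theorem setIntegral_one_le_norm_cpow_mul {s : ℂ} (hs : 0 < s.re) :
    ∫ x in {x : ℚ_[p] | (p : ℝ) ^ (0 : ℤ) ≤ ‖x‖}, (‖x‖ : ℂ) ^ (-1 - s) * θ (-x) ∂μ =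
      (1 - (p : ℂ)⁻¹) - (p : ℂ) ^ (-1 - s) := by
  have := isFiniteMeasureOnCompacts_of_closedBall μ h1
  have hi := integrableOn_norm_cpow_mul μ h1 hθ_cont hθ_unit hs 0
  rw [← iUnion_sphere_zpow_add] at hi ⊢
  refine (hasSum_integral_iUnion (fun j ↦ Metric.isClosed_sphere.measurableSet)
    (pairwise_disjoint_sphere_zpow_add 0) hi).unique ?_
  simp only [setIntegral_sphere_norm_cpow_mul]
  convert hasSum_sum_of_ne_finset_zero (L := .unconditional ℕ)
    (s := Finset.range 2) ?_ using 1
  · rw [Finset.sum_range_succ, Finset.sum_range_one]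
    simp only [Nat.cast_one, zero_add, Nat.cast_zero]
    rw [setIntegral_sphere_neg_one μ h1 hθ_cont hθ_add hθ_triv hθ_nontriv,
      setIntegral_sphere_neg μ hθ_cont,
      setIntegral_closedBall_neg_of_nonpos μ h1 hθ_triv le_rfl,
      setIntegral_closedBall_neg_of_nonpos μ h1 hθ_triv (by simp)]
    simp [sub_eq_add_neg]
  · intro j hj
    rw [setIntegral_sphere_neg_of_two_le μ h1 hθ_cont hθ_add hθ_triv hθ_nontriv, mul_zero]
    simp at hj
    lia

end

theorem addValuation_le_addValuation_iff_s19 {x y : ℚ_[p]} :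
    addValuation x ≤ addValuation y ↔ ‖y‖ ≤ ‖x‖ := by
  have hp1 : (1 : ℝ) < p := mod_cast (Fact.out : p.Prime).one_lt
  rcases eq_or_ne y 0 with rfl | hy
  · simp
  rcases eq_or_ne x 0 with rfl | hx
  · simp [hy]
  rw [addValuation.apply hx, addValuation.apply hy, norm_eq_zpow_neg_valuation hx,
    norm_eq_zpow_neg_valuation hy, zpow_le_zpow_iff_right₀ hp1, neg_le_neg_iff, WithTop.coe_le_coe]

theorem addValuation_le_neg_one_iff {x : ℚ_[p]} :
    addValuation x ≤ ((-1 : ℤ) : WithTop ℤ) ↔ (p : ℝ) ≤ ‖x‖ := by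
  have hp0 : (p : ℚ_[p]) ≠ 0 := mod_cast (Fact.out : p.Prime).ne_zero
  have h : ((-1 : ℤ) : WithTop ℤ) = addValuation (p : ℚ_[p])⁻¹ := by
    rw [addValuation.apply (inv_ne_zero hp0), valuation_inv, valuation_p]
  rw [h, addValuation_le_addValuation_iff_s19]
  simp

theorem addValuation_neg_iff {x : ℚ_[p]} : addValuation x < 0 ↔ 1 < ‖x‖ := by
  simpa using (addValuation_le_addValuation_iff_s19 (x := (1 : ℚ_[p])) (y := x)).not

/-- The shear `(a, b, c, x) ↦ (a + b² / c, b, c, x - b / c)`. -/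
noncomputable def shear (q : ℚ_[p] × ℚ_[p] × ℚ_[p] × ℚ_[p]) : ℚ_[p] × ℚ_[p] × ℚ_[p] × ℚ_[p] :=
  (q.1 + q.2.1 ^ 2 / q.2.2.1, q.2.1, q.2.2.1, q.2.2.2 - q.2.1 / q.2.2.1)

/-- The part of the sheared domain on which `‖c‖ = p ^ n`. -/
def shell (p : ℕ) [Fact p.Prime] (n : ℤ) : Set (ℚ_[p] × ℚ_[p] × ℚ_[p] × ℚ_[p]) :=
  Metric.closedBall 0 ((p : ℝ) ^ (0 : ℤ)) ×ˢ Metric.closedBall 0 ((p : ℝ) ^ n) ×ˢ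
    Metric.sphere 0 ((p : ℝ) ^ n) ×ˢ {x | (p : ℝ) ^ (1 - n) ≤ ‖x‖}

theorem one_lt_norm_mul_iff {c x : ℚ_[p]} {n : ℤ} (hc : ‖c‖ = (p : ℝ) ^ n) :
    1 < ‖c * x‖ ↔ (p : ℝ) ^ (1 - n) ≤ ‖x‖ := by
  have hp0 : (0 : ℝ) < p := mod_cast (Fact.out : p.Prime).pos
  have := norm_le_pow_iff_norm_lt_pow_add_one (c * x) 0
  rw [zpow_zero, zero_add, zpow_one] at this
  rw [← not_le, this, not_lt, norm_mul, hc, zpow_sub₀ hp0.ne', zpow_one,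
    div_le_iff₀' (by positivity)]

theorem preimage_shear_eq_iUnion_shell :
    shear ⁻¹' {q : ℚ_[p] × ℚ_[p] × ℚ_[p] × ℚ_[p] | addValuation q.2.2.1 ≤
        min ((-1 : ℤ) : WithTop ℤ)
          (min (addValuation q.2.1) (addValuation (q.1 * q.2.2.1 - q.2.1 ^ 2))) ∧
        addValuation (q.2.1 + q.2.2.1 * q.2.2.2) < 0} = ⋃ j : ℕ, shell p (1 + j) := by
  have hp0 : (0 : ℝ) < p := mod_cast (Fact.out : p.Prime).pos
  have hU := iUnion_sphere_zpow_add (p := p) 1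
  ext ⟨a, b, c, x⟩
  have hc := Set.ext_iff.1 hU c
  simp only [Set.mem_iUnion, mem_sphere_zero_iff_norm, Set.mem_ofPred_eq, zpow_one] at hc
  simp only [Set.mem_preimage, shear, Set.mem_ofPred_eq, le_min_iff, addValuation_neg_iff,
    addValuation_le_neg_one_iff, addValuation_le_addValuation_iff_s19, Set.mem_iUnion, shell,
    Set.mem_prod, mem_closedBall_zero_iff, mem_sphere_zero_iff_norm, ← hc, zpow_zero]
  have key (j : ℕ) (hj : ‖c‖ = (p : ℝ) ^ (1 + j : ℤ)) :
      ‖(a + b ^ 2 / c) * c - b ^ 2‖ = ‖a‖ * ‖c‖ ∧ b + c * (x - b / c) = c * x := by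
    have hc0 : c ≠ 0 := by
      rintro rfl
      rw [norm_zero] at hj
      exact (zpow_pos hp0 _).ne hj
    constructor
    · rw [← norm_mul]; congr 1; field_simp; ring
    · field_simp; ring
  constructor
  · rintro ⟨⟨⟨j, hj⟩, hb, ha⟩, hx⟩
    rw [(key j hj).1, hj] at ha
    rw [(key j hj).2, one_lt_norm_mul_iff hj] at hx
    exact ⟨j, (mul_le_iff_le_one_left (by positivity)).1 ha, hj ▸ hb, hj, hx⟩
  · rintro ⟨j, ha, hb, hj, hx⟩
    rw [(key j hj).1, (key j hj).2, one_lt_norm_mul_iff hj]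
    exact ⟨⟨⟨j, hj⟩, hj ▸ hb, mul_le_of_le_one_left (norm_nonneg _) ha⟩, hx⟩

theorem pairwise_disjoint_shell :
    Pairwise (Function.onFun Disjoint fun j : ℕ ↦ shell p (1 + j)) := fun _ _ hij ↦
  Set.disjoint_left.2 fun _ hi hj ↦
    Set.disjoint_left.1 (pairwise_disjoint_sphere_zpow_add 1 hij) hi.2.2.1 hj.2.2.1

theorem integrand_shear_eq {θ : ℚ_[p] → ℂ} (hθ_add : ∀ a b : ℚ_[p], θ (a + b) = θ a * θ b)
    (hθ_triv : ∀ a : ℚ_[p], ‖a‖ ≤ 1 → θ a = 1) (ν₁ ν₂ : ℂ) {n : ℤ}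
    {q : ℚ_[p] × ℚ_[p] × ℚ_[p] × ℚ_[p]} (hq : q ∈ shell p n) :
    (‖(shear q).2.1 + (shear q).2.2.1 * (shear q).2.2.2‖ : ℂ) ^ (-1 - ν₁ + ν₂) *
        (‖(shear q).2.2.1‖ : ℂ) ^ (-1 - ν₂) * θ (-(shear q).2.2.2 - (shear q).2.2.1) =
      (((p : ℝ) ^ n : ℝ) : ℂ) ^ (-2 - ν₁) *
        (1 * (θ (-q.2.2.1) * ((‖q.2.2.2‖ : ℂ) ^ (-1 - (ν₁ - ν₂)) * θ (-q.2.2.2)))) := by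
  have hp0 : (0 : ℝ) < p := mod_cast (Fact.out : p.Prime).pos
  obtain ⟨a, b, c, x⟩ := q
  obtain ⟨-, hb, hc, -⟩ := hq
  simp only [mem_closedBall_zero_iff, mem_sphere_zero_iff_norm] at hb hc
  have hpn : (0 : ℝ) < (p : ℝ) ^ n := by positivity
  have hc0 : c ≠ 0 := norm_pos_iff.1 (hc ▸ hpn)
  have e1 : b + c * (x - b / c) = c * x := by field_simp; ring
  have e2 : -(x - b / c) - c = b / c + (-c + -x) := by ring
  have e3 : θ (b / c) = 1 := hθ_triv _ (by
    rw [norm_div, hc]; exact div_le_one_of_le₀ hb hpn.le)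
  simp only [shear]
  rw [e1, e2, hθ_add, hθ_add, e3, norm_mul, hc, Complex.ofReal_mul,
    Complex.mul_cpow_ofReal_nonneg hpn.le (norm_nonneg _),
    show -2 - ν₁ = (-1 - ν₁ + ν₂) + (-1 - ν₂) by ring,
    Complex.cpow_add (-1 - ν₁ + ν₂) (-1 - ν₂) (Complex.ofReal_ne_zero.2 hpn.ne'),
    show -1 - (ν₁ - ν₂) = -1 - ν₁ + ν₂ by ring]
  ring

theorem setIntegral_shell_mul [MeasurableSpace ℚ_[p]] (μ : Measure ℚ_[p]) [SigmaFinite μ]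
    {L : Type*} [RCLike L] (C : L) (f g : ℚ_[p] → L)
    (n : ℤ) :
    ∫ q in shell p n, C * (1 * (f q.2.2.1 * g q.2.2.2)) ∂(μ.prod (μ.prod (μ.prod μ))) =
      (∫ _ in Metric.closedBall (0 : ℚ_[p]) ((p : ℝ) ^ (0 : ℤ)), C ∂μ) *
        ((∫ _ in Metric.closedBall (0 : ℚ_[p]) ((p : ℝ) ^ n), 1 ∂μ) *
          ((∫ c in Metric.sphere (0 : ℚ_[p]) ((p : ℝ) ^ n), f c ∂μ) *
            ∫ x in {x | (p : ℝ) ^ (1 - n) ≤ ‖x‖}, g x ∂μ)) := by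
  rw [shell, setIntegral_prod_mul (fun _ : ℚ_[p] ↦ C)
      (fun w : ℚ_[p] × ℚ_[p] × ℚ_[p] ↦ 1 * (f w.2.1 * g w.2.2)),
    setIntegral_prod_mul (fun _ : ℚ_[p] ↦ (1 : L))
      (fun w : ℚ_[p] × ℚ_[p] ↦ f w.1 * g w.2), setIntegral_prod_mul f g]

section

variable [MeasurableSpace ℚ_[p]] [BorelSpace ℚ_[p]] (μ : Measure ℚ_[p])

theorem measurePreserving_shear [SigmaFinite μ] [μ.IsAddLeftInvariant] :
    MeasurePreserving (shear (p := p)) (μ.prod (μ.prod (μ.prod μ)))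
      (μ.prod (μ.prod (μ.prod μ))) := by
  have hA : MeasurePreserving
      (fun q : (ℚ_[p] × ℚ_[p] × ℚ_[p]) × ℚ_[p] ↦ (q.1, q.1.1 ^ 2 / q.1.2.1 + q.2))
      ((μ.prod (μ.prod μ)).prod μ) ((μ.prod (μ.prod μ)).prod μ) :=
    (MeasurePreserving.id _).skew_product
      (g := fun (w : ℚ_[p] × ℚ_[p] × ℚ_[p]) (a : ℚ_[p]) ↦ w.1 ^ 2 / w.2.1 + a)
      (by unfold Function.uncurry; fun_prop) (.of_forall fun w ↦ map_add_left_eq_self μ _)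
  have hC (b : ℚ_[p]) : MeasurePreserving
      (fun q : ℚ_[p] × ℚ_[p] ↦ (q.1, -(b / q.1) + q.2)) (μ.prod μ) (μ.prod μ) :=
    (MeasurePreserving.id _).skew_product (g := fun (c x : ℚ_[p]) ↦ -(b / c) + x)
      (by unfold Function.uncurry; fun_prop) (.of_forall fun w ↦ map_add_left_eq_self μ _)
  have hB : MeasurePreserving
      (fun q : ℚ_[p] × ℚ_[p] × ℚ_[p] ↦ (q.1, q.2.1, -(q.1 / q.2.1) + q.2.2))
      (μ.prod (μ.prod μ)) (μ.prod (μ.prod μ)) :=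
    (MeasurePreserving.id _).skew_product
      (g := fun (b : ℚ_[p]) (w : ℚ_[p] × ℚ_[p]) ↦ (w.1, -(b / w.1) + w.2))
      (by unfold Function.uncurry; fun_prop) (.of_forall fun b ↦ (hC b).map_eq)
  convert ((MeasurePreserving.id μ).prod hB).comp (Measure.measurePreserving_swap.comp
    (hA.comp Measure.measurePreserving_swap)) using 1
  ext q <;> simp [shear, add_comm, sub_eq_add_neg]

theorem measurableSet_shell (n : ℤ) : MeasurableSet (shell p n) :=
  Metric.isClosed_closedBall.measurableSet.prod (Metric.isClosed_closedBall.measurableSet.prod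
    (Metric.isClosed_sphere.measurableSet.prod (measurableSet_le measurable_const measurable_norm)))

theorem integrableOn_shell_mul [SigmaFinite μ] [IsFiniteMeasureOnCompacts μ] (C : ℂ)
    {f g : ℚ_[p] → ℂ} (n : ℤ) (hf : IntegrableOn f (Metric.sphere (0 : ℚ_[p]) ((p : ℝ) ^ n)) μ)
    (hg : IntegrableOn g {x | (p : ℝ) ^ (1 - n) ≤ ‖x‖} μ) :
    IntegrableOn (fun q ↦ C * (1 * (f q.2.2.1 * g q.2.2.2))) (shell p n)
      (μ.prod (μ.prod (μ.prod μ))) := by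
  have hball (k : ℤ) (C : ℂ) : IntegrableOn (fun _ ↦ C)
      (Metric.closedBall (0 : ℚ_[p]) ((p : ℝ) ^ k)) μ :=
    continuousOn_const.integrableOn_compact (isCompact_closedBall _ _)
  rw [IntegrableOn, shell, ← Measure.prod_restrict, ← Measure.prod_restrict,
    ← Measure.prod_restrict]
  exact (hball 0 C).mul_prod ((hball n 1).mul_prod (hf.mul_prod hg))

end

end Padic

/-- For `Re(ν₂)` and `Re(ν₁−ν₂)` large enough, with `(a,b,c,x) = q`,
the function `|b+cx|^{−1−ν₁+ν₂}·|c|^{−1−ν₂}·θ(−x−c)` is absolutely integrable on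
`R = {v(c) ≤ min{−1, v(b), v(ac−b²)}, v(b+cx) < 0}` and its integral equals
`p^{−2−2ν₁+ν₂} − (1−p⁻¹)p^{−1−ν₁}`. -/
theorem stmt_19 (p : ℕ) [Fact p.Prime]
    [MeasurableSpace ℚ_[p]] [BorelSpace ℚ_[p]]
    (μ : Measure ℚ_[p]) [SigmaFinite μ]
    (hμ_inv : ∀ a : ℚ_[p], μ.map (a + ·) = μ)
    (hμ_norm : μ {x : ℚ_[p] | ‖x‖ ≤ 1} = 1)
    (θ : ℚ_[p] → ℂ) (hθ_cont : Continuous θ)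
    (hθ_add : ∀ a b : ℚ_[p], θ (a + b) = θ a * θ b)
    (hθ_unit : ∀ a : ℚ_[p], ‖θ a‖ = 1)
    (hθ_triv : ∀ a : ℚ_[p], ‖a‖ ≤ 1 → θ a = 1)
    (hθ_nontriv : ∃ a : ℚ_[p], ‖a‖ ≤ (p : ℝ) ∧ θ a ≠ 1) :
    ∃ T : ℝ, ∀ ν₁ ν₂ : ℂ, T < ν₂.re → T < (ν₁ - ν₂).re →
      IntegrableOn
        (fun q : ℚ_[p] × ℚ_[p] × ℚ_[p] × ℚ_[p] =>
          (‖q.2.1 + q.2.2.1 * q.2.2.2‖ : ℂ) ^ (-1 - ν₁ + ν₂) *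
            (‖q.2.2.1‖ : ℂ) ^ (-1 - ν₂) * θ (-q.2.2.2 - q.2.2.1))
        {q : ℚ_[p] × ℚ_[p] × ℚ_[p] × ℚ_[p] | Padic.addValuation q.2.2.1 ≤
            min ((-1 : ℤ) : WithTop ℤ)
              (min (Padic.addValuation q.2.1)
                (Padic.addValuation (q.1 * q.2.2.1 - q.2.1 ^ 2))) ∧
          Padic.addValuation (q.2.1 + q.2.2.1 * q.2.2.2) < 0}
        (μ.prod (μ.prod (μ.prod μ))) ∧
      ∫ q in {q : ℚ_[p] × ℚ_[p] × ℚ_[p] × ℚ_[p] | Padic.addValuation q.2.2.1 ≤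
            min ((-1 : ℤ) : WithTop ℤ)
              (min (Padic.addValuation q.2.1)
                (Padic.addValuation (q.1 * q.2.2.1 - q.2.1 ^ 2))) ∧
          Padic.addValuation (q.2.1 + q.2.2.1 * q.2.2.2) < 0},
          (‖q.2.1 + q.2.2.1 * q.2.2.2‖ : ℂ) ^ (-1 - ν₁ + ν₂) *
            (‖q.2.2.1‖ : ℂ) ^ (-1 - ν₂) * θ (-q.2.2.2 - q.2.2.1)
          ∂(μ.prod (μ.prod (μ.prod μ))) =
        (p : ℂ) ^ (-2 - 2 * ν₁ + ν₂) -
          (1 - (p : ℂ)⁻¹) * (p : ℂ) ^ (-1 - ν₁) := by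
  have : μ.IsAddLeftInvariant := ⟨hμ_inv⟩
  have := Padic.isFiniteMeasureOnCompacts_of_closedBall μ hμ_norm
  have hp0 : (0 : ℝ) < p := mod_cast (Fact.out : p.Prime).pos
  have hpC : (p : ℂ) ≠ 0 := mod_cast (Fact.out : p.Prime).ne_zero
  refine ⟨0, fun ν₁ ν₂ hν₂ hs ↦ ?_⟩
  set F := fun q : ℚ_[p] × ℚ_[p] × ℚ_[p] × ℚ_[p] ↦
    (‖q.2.1 + q.2.2.1 * q.2.2.2‖ : ℂ) ^ (-1 - ν₁ + ν₂) *
      (‖q.2.2.1‖ : ℂ) ^ (-1 - ν₂) * θ (-q.2.2.2 - q.2.2.1) with hF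
  set R := {q : ℚ_[p] × ℚ_[p] × ℚ_[p] × ℚ_[p] | Padic.addValuation q.2.2.1 ≤
      min ((-1 : ℤ) : WithTop ℤ)
        (min (Padic.addValuation q.2.1) (Padic.addValuation (q.1 * q.2.2.1 - q.2.1 ^ 2))) ∧
      Padic.addValuation (q.2.1 + q.2.2.1 * q.2.2.2) < 0} with hR
  have hFm : Measurable F := by
    have := hθ_cont.measurable
    fun_prop
  have hRm : MeasurableSet R := by
    simp only [hR, le_min_iff, Padic.addValuation_neg_iff, Padic.addValuation_le_neg_one_iff,
      Padic.addValuation_le_addValuation_iff_s19]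
    simp only [Set.ofPred_and]
    exact .inter (.inter (measurableSet_le (by fun_prop) (by fun_prop))
      (.inter (measurableSet_le (by fun_prop) (by fun_prop))
        (measurableSet_le (by fun_prop) (by fun_prop))))
      (measurableSet_lt (by fun_prop) (by fun_prop))
  have hmp := (Padic.measurePreserving_shear μ).restrict_preimage hRm
  rw [Padic.preimage_shear_eq_iUnion_shell] at hmp
  have hcongr (j : ℕ) : ∀ q ∈ Padic.shell p (1 + j), (F ∘ Padic.shear) q = _ := fun q hq ↦
    Padic.integrand_shear_eq hθ_add hθ_triv ν₁ ν₂ hq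
  have hmeas (j : ℕ) := Padic.measurableSet_shell (p := p) (1 + j)
  have hint : IntegrableOn (F ∘ Padic.shear) (⋃ j : ℕ, Padic.shell p (1 + j))
      (μ.prod (μ.prod (μ.prod μ))) := by
    refine integrableOn_iUnion_of_summable_integral_norm (fun j ↦ ?_) ?_
    · refine (Padic.integrableOn_shell_mul μ _ _
        (hθ_cont.comp continuous_neg |>.continuousOn.integrableOn_compact (isCompact_sphere _ _))
        (Padic.integrableOn_norm_cpow_mul μ hμ_norm hθ_cont hθ_unit hs _)).congr_fun
        (fun q hq ↦ (hcongr j q hq).symm) (hmeas j)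
    · convert Padic.summable_rpow_neg_zpow_add (p := p) hν₂ 1 (((p : ℝ) ^ (-(ν₁ - ν₂).re)) *
        ((1 - (p : ℝ)⁻¹) * ∑' j : ℕ, ((p : ℝ) ^ (-(ν₁ - ν₂).re)) ^ j * (1 - (p : ℝ)⁻¹)))
        using 2 with j
      rw [setIntegral_congr_fun (hmeas j) fun q hq ↦ congrArg norm (hcongr j q hq)]
      simp only [norm_mul _ ((1 : ℂ) * _), norm_mul (1 : ℂ) _, norm_mul (θ _) _, norm_one, hθ_unit]
      rw [Padic.setIntegral_shell_mul μ _ (fun _ ↦ (1 : ℝ))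
        (fun x ↦ ‖(‖x‖ : ℂ) ^ (-1 - (ν₁ - ν₂)) * θ (-x)‖),
        Padic.setIntegral_norm_norm_cpow_mul μ hμ_norm hθ_cont hθ_unit hs, setIntegral_const,
        setIntegral_const, setIntegral_const, Padic.measureReal_closedBall_zpow μ hμ_norm,
        Padic.measureReal_closedBall_zpow μ hμ_norm, Padic.measureReal_sphere_zpow μ hμ_norm,
        Complex.norm_cpow_eq_rpow_re_of_pos (by positivity)]
      set S := ∑' j : ℕ, ((p : ℝ) ^ (-(ν₁ - ν₂).re)) ^ j * (1 - (p : ℝ)⁻¹)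
      set n : ℤ := 1 + j
      have e : ((p : ℝ) ^ n) ^ (-2 - ν₁).re * (p : ℝ) ^ n * (p : ℝ) ^ n *
          ((p : ℝ) ^ (-(ν₁ - ν₂).re)) ^ (1 - n) =
          ((p : ℝ) ^ (-ν₂.re)) ^ n * ((p : ℝ) ^ (-(ν₁ - ν₂).re)) := by
        simp only [← Real.rpow_intCast]
        simp only [← Real.rpow_mul hp0.le, ← Real.rpow_add hp0]
        congr 1
        simp
        ring
      simp only [smul_eq_mul, mul_one, zpow_zero, one_mul]
      linear_combination (1 - (p : ℝ)⁻¹) * S * e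
  refine ⟨(hmp.integrable_comp hFm.aestronglyMeasurable).1 hint, ?_⟩
  rw [← hmp.map_eq, integral_map hmp.measurable.aemeasurable hFm.aestronglyMeasurable]
  refine (hasSum_integral_iUnion hmeas Padic.pairwise_disjoint_shell hint).unique ?_
  convert hasSum_single 0 fun j hj ↦ ?_ using 1
  · rw [setIntegral_congr_fun (hmeas 0) (hcongr 0), Padic.setIntegral_shell_mul μ _
      (fun c ↦ θ (-c)) (fun x ↦ (‖x‖ : ℂ) ^ (-1 - (ν₁ - ν₂)) * θ (-x))]
    simp only [Nat.cast_zero, add_zero, sub_self]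
    rw [Padic.setIntegral_sphere_neg_one μ hμ_norm hθ_cont hθ_add hθ_triv hθ_nontriv,
      Padic.setIntegral_one_le_norm_cpow_mul μ hμ_norm hθ_cont hθ_add hθ_unit hθ_triv hθ_nontriv
      hs, setIntegral_const, setIntegral_const, Padic.measureReal_closedBall_zpow μ hμ_norm,
        Padic.measureReal_closedBall_zpow μ hμ_norm]
    have e1 : (p : ℂ) ^ (-1 - ν₁) = (p : ℂ) ^ (-2 - ν₁) * p := by
      rw [show -1 - ν₁ = -2 - ν₁ + 1 by ring, Complex.cpow_add _ _ hpC, Complex.cpow_one]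
    have e2 : (p : ℂ) ^ (-2 - 2 * ν₁ + ν₂) = (p : ℂ) ^ (-1 - ν₁) * (p : ℂ) ^ (-1 - (ν₁ - ν₂)) := by
      rw [← Complex.cpow_add _ _ hpC]; ring_nf
    rw [e2, e1]
    simp
    ring
  · rw [setIntegral_congr_fun (hmeas j) (hcongr j), Padic.setIntegral_shell_mul μ _
      (fun c ↦ θ (-c)) (fun x ↦ (‖x‖ : ℂ) ^ (-1 - (ν₁ - ν₂)) * θ (-x)),
      Padic.setIntegral_sphere_neg_of_two_le μ hμ_norm hθ_cont hθ_add hθ_triv hθ_nontriv (by lia)]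
    simp
end
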